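/- Let K be a field, P_0 = K[x_1,…,x_m], P = K[x_1,…,x_m,y_1,…,y_n] bigraded with deg x_i = (1,0) and deg y_j = (0,1), and P_+ = (y_1,…,y_n). Let M be a finitely generated bigraded P-module such that dim_{P_0} M/P_+M ≤ 1. Then for every i the function f_{i,M}(j) = reg H^i_{P_+}(M)_j is bounded, i.e., there is a constant C with |reg H^i_{P_+}(M)_j| ≤ C for all j with H^i_{P_+}(M)_j ≠ 0. -/

import Mathlib

/-!
Formalization of a statement from "On the regularity of local cohomology of bigraded algebras"
(A. Rahimi). Here `P₀ = K[x₁,…,x_m]`, `P = P₀[y₁,…,yₙ]` is bigraded with `deg xᵢ = (1,0)`,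
`deg yⱼ = (0,1)`, and `P₊ = (y₁,…,yₙ)`.  The top local cohomology `H^n_{P₊}(P)` is the free
`P₀`-module `⊕_c P₀ z^c` (`c : Fin n →₀ ℕ`, `z^c` of bidegree `(0, -n - |c|)`), on which a
bihomogeneous `f = Σ_β f_β y^β ∈ P` acts by the contraction `f ⬝ z^c = Σ_{β ≤ c} f_β z^{c-β}`.
For a hypersurface ring `R = P/fP` this yields the exact presentation
`⊕_{|c| = -n-j+b} P₀(-a) z^c → ⊕_{|c| = -n-j} P₀ z^c → H^n_{P₊}(R)_j → 0`
(with `(a,b) = bideg f`), and `H^{n-1}_{P₊}(R)_j` is the kernel of the first map.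
-/

open MvPolynomial

namespace Paper

/-- Total degree of an exponent vector. -/
def tdeg {n : ℕ} (c : Fin n →₀ ℕ) : ℕ := c.sum fun _ e => e

variable (A : Type) [CommRing A] (n : ℕ)

/-- The underlying module of the top local cohomology `H^n_{P₊}(P)` of `P = A[y₁,…,yₙ]`:
the free `A`-module with basis `z^c`, `c : Fin n →₀ ℕ` (`z^c` lies in `y`-degree `-n - |c|`). -/
abbrev Wmod := (Fin n →₀ ℕ) →₀ A

/-- The free `A`-submodule of `Wmod` spanned by the `z^c` with `|c| = k`;
this is the graded component `H^n_{P₊}(P)_j` for `j = -n-k`. -/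
noncomputable def Fk (k : ℕ) : Submodule A (Wmod A n) :=
  Finsupp.supported A A {c | tdeg c = k}

open scoped Classical in
/-- The contraction action of `f ∈ P = A[y₁,…,yₙ]` on `H^n_{P₊}(P)`:
`f ⬝ z^c = Σ_{β ≤ c} f_β z^{c-β}`, where `f = Σ_β f_β y^β` with `f_β ∈ A`. -/
noncomputable def contract (f : MvPolynomial (Fin n) A) :
    Wmod A n →ₗ[A] Wmod A n :=
  Finsupp.lsum A fun c =>
    (LinearMap.id : A →ₗ[A] A).smulRight
      (f.support.sum fun β => if β ≤ c then Finsupp.single (c - β) (MvPolynomial.coeff β f) else 0)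

section Resolutions

variable (A : Type) [CommRing A] (n : ℕ)

/-- The underlying module of `H^n_{P₊}(⊕_{s : σ} P)`, for `P = A[y₁,…,yₙ]`: the free
`A`-module with basis `z^c` in each summand, i.e. with basis indexed by `σ × (Fin n →₀ ℕ)`. -/
abbrev Emod (σ : Type) := (σ × (Fin n →₀ ℕ)) →₀ A

/-- The map induced on top local cohomology `H^n_{P₊}(-)` by a `P`-linear map
`φ : ⊕_{s' : σ'} P → ⊕_{s : σ} P` of free `P`-modules, `P = A[y₁,…,yₙ]`:
`H^n_{P₊}(F) = F ⊗_P H^n_{P₊}(P)`, and the matrix entries of `φ` act by contraction. -/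
noncomputable def emap {σ' σ : Type}
    (φ : (σ' →₀ MvPolynomial (Fin n) A) →ₗ[MvPolynomial (Fin n) A]
      (σ →₀ MvPolynomial (Fin n) A)) :
    Emod A n σ' →ₗ[A] Emod A n σ :=
  Finsupp.lsum A fun p =>
    (LinearMap.id : A →ₗ[A] A).smulRight
      ((φ (Finsupp.single p.1 1)).support.sum fun s =>
        Finsupp.mapDomain (fun c => (s, c))
          (contract A n ((φ (Finsupp.single p.1 1)) s) (Finsupp.single p.2 1)))

/-- The `y`-degree-`j` strand of `H^n_{P₊}(⊕_{s : σ} P(•, -bdeg s))`: in the summand indexed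
by `s`, the basis element `z^c` has `y`-degree `-n - |c| + bdeg s`. -/
def ystrand {σ : Type} (bdeg : σ → ℤ) (j : ℤ) : Submodule A (Emod A n σ) where
  carrier := {w | ∀ s c, w (s, c) ≠ 0 → (tdeg c : ℤ) = bdeg s - n - j}
  add_mem' := by
    intro a b ha hb s c h
    rw [Finsupp.add_apply] at h
    by_cases h1 : a (s, c) ≠ 0
    · exact ha s c h1
    · push_neg at h1
      exact hb s c (by simpa [h1] using h)
  zero_mem' := by intro s c h; simp at h
  smul_mem' := by
    intro p w hw s c h
    rw [Finsupp.smul_apply] at h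
    exact hw s c (right_ne_zero_of_smul h)

/-- The cycles, at homological position `i`, of the complex obtained by applying
`H^n_{P₊}(-)` to a graded free resolution `⋯ → F₁ → F₀` (with `Fᵢ = ⊕_{σ i} P`). -/
noncomputable def hKer (σ : ℕ → Type)
    (φ : ∀ i, ((σ (i + 1)) →₀ MvPolynomial (Fin n) A) →ₗ[MvPolynomial (Fin n) A]
      ((σ i) →₀ MvPolynomial (Fin n) A)) :
    ∀ i, Submodule A (Emod A n (σ i))
  | 0 => ⊤
  | i + 1 => LinearMap.ker (emap A n (φ i))

/-- The `y`-degree-`j` component of `H_i(H^n_{P₊}(F))`, which by Theorem 1.1 of the paper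
is the component `H^{n-i}_{P₊}(M)_j` of local cohomology when `F` is a graded free
resolution of `M`: the image of the degree-`j` cycles in the quotient by the boundaries. -/
noncomputable def Hy (σ : ℕ → Type)
    (φ : ∀ i, ((σ (i + 1)) →₀ MvPolynomial (Fin n) A) →ₗ[MvPolynomial (Fin n) A]
      ((σ i) →₀ MvPolynomial (Fin n) A))
    (bdeg : ∀ i, σ i → ℤ) (i : ℕ) (j : ℤ) :
    Submodule A ((Emod A n (σ i)) ⧸ LinearMap.range (emap A n (φ i))) :=
  Submodule.map (LinearMap.range (emap A n (φ i))).mkQ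
    (hKer A n σ φ i ⊓ ystrand A n (bdeg i) j)

end Resolutions

section CMregularity

variable (K : Type) [Field K] (m : ℕ)
variable (N : Type) [AddCommGroup N] [Module (MvPolynomial (Fin m) K) N]
  [Module K N] [IsScalarTower K (MvPolynomial (Fin m) K) N]

/-- The Koszul differential on `x₁,…,x_m` with values in the `P₀ = K[x₁,…,x_m]`-module `N`;
the Koszul complex on `x₁,…,x_m` is a graded free resolution of `K` over `P₀`, so its homology
with values in `N` computes the graded modules `Tor_i^{P₀}(N, K)`. -/
noncomputable def kosD (i : ℕ) :
    ({S : Finset (Fin m) // S.card = i + 1} →₀ N) →ₗ[MvPolynomial (Fin m) K]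
      ({S : Finset (Fin m) // S.card = i} →₀ N) :=
  Finsupp.lsum (MvPolynomial (Fin m) K) fun S =>
    S.1.attach.sum fun l =>
      ((-1 : ℤ) ^ (S.1.filter (fun l' => l' < l.1)).card) •
        ((Finsupp.lsingle (⟨S.1.erase l.1, by
            simp [Finset.card_erase_of_mem l.2, S.2]⟩ :
            {T : Finset (Fin m) // T.card = i})).comp
          (LinearMap.lsmul (MvPolynomial (Fin m) K) N (MvPolynomial.X l.1)))

/-- The cycles of the Koszul complex with values in `N` at homological degree `i`. -/
noncomputable def kosKer : ∀ i : ℕ,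
    Submodule (MvPolynomial (Fin m) K) ({S : Finset (Fin m) // S.card = i} →₀ N)
  | 0 => ⊤
  | i + 1 => LinearMap.ker (kosD K m N i)

/-- The (internal) degree-`e` strand of the `i`-th Koszul module (the basis element `e_S`,
`|S| = i`, has internal degree `i`), relative to a grading `ℬ` of `N`. -/
def kosStrand (ℬ : ℤ → Submodule K N) (i : ℕ) (e : ℤ) :
    Submodule K ({S : Finset (Fin m) // S.card = i} →₀ N) where
  carrier := {w | ∀ S, w S ∈ ℬ (e - i)}
  add_mem' := by
    intro a b ha hb S
    rw [Finsupp.add_apply]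
    exact add_mem (ha S) (hb S)
  zero_mem' := by intro S; simp
  smul_mem' := by
    intro k w hw S
    rw [Finsupp.smul_apply]
    exact Submodule.smul_mem _ _ (hw S)

/-- The Castelnuovo–Mumford regularity over `P₀ = K[x₁,…,x_m]` of a finitely generated
graded `P₀`-module `N` with grading `ℬ`:
`reg N = max { e : Tor_i^{P₀}(N, K)_{e+i} ≠ 0 for some i }`, where the graded `Tor` modules
are computed as the homology of the graded Koszul complex on `x₁,…,x_m` with values in `N`. -/
noncomputable def CMreg (ℬ : ℤ → Submodule K N) : ℤ :=
  sSup {e : ℤ | ∃ i : ℕ,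
    Submodule.map ((LinearMap.range (kosD K m N i)).mkQ.restrictScalars K)
      (kosStrand K m N ℬ i (e + i) ⊓ (kosKer K m N i).restrictScalars K) ≠ ⊥}

end CMregularity

section BigradedResolutions

variable (K : Type) [Field K] (m n : ℕ)

/-- `f ∈ P = K[x₁,…,x_m][y₁,…,yₙ]` is bihomogeneous of bidegree `(a,b)`:
every monomial `x^ν y^β` occurring in `f` has `|ν| = a` and `|β| = b`. -/
def IsBihom (f : MvPolynomial (Fin n) (MvPolynomial (Fin m) K)) (a b : ℕ) : Prop :=
  ∀ β ν, MvPolynomial.coeff ν (MvPolynomial.coeff β f) ≠ 0 → tdeg ν = a ∧ tdeg β = b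

/-- The `x`-degree-`d` strand of `H^n_{P₊}(⊕_{s : σ} P(-adeg s, •))`: in the summand indexed
by `s`, the coefficients of `z^c` must be homogeneous of degree `d - adeg s`. -/
def xstrandE {σ : Type} (adeg : σ → ℤ) (d : ℤ) :
    Submodule K (Emod (MvPolynomial (Fin m) K) n σ) where
  carrier := {w | ∀ s c ν, MvPolynomial.coeff ν (w (s, c)) ≠ 0 → (tdeg ν : ℤ) = d - adeg s}
  add_mem' := by
    intro a b ha hb s c ν h
    rw [Finsupp.add_apply, MvPolynomial.coeff_add] at h
    by_cases h1 : MvPolynomial.coeff ν (a (s, c)) ≠ 0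
    · exact ha s c ν h1
    · push_neg at h1
      exact hb s c ν (by simpa [h1] using h)
  zero_mem' := by intro s c ν h; simp at h
  smul_mem' := by
    intro k w hw s c ν h
    rw [Finsupp.smul_apply, MvPolynomial.coeff_smul] at h
    exact hw s c ν (right_ne_zero_of_smul h)

/-- The `x`-grading of the `y`-degree-`j` component `H^{n-i}_{P₊}(M)_j = H_i(H^n_{P₊}(F))_j`
of local cohomology, computed from a bigraded free resolution `F` of `M` with bidegree
twists `D`. -/
noncomputable def HyGr (σ : ℕ → Type)
    (φ : ∀ i, ((σ (i + 1)) →₀ MvPolynomial (Fin n) (MvPolynomial (Fin m) K))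
      →ₗ[MvPolynomial (Fin n) (MvPolynomial (Fin m) K)]
      ((σ i) →₀ MvPolynomial (Fin n) (MvPolynomial (Fin m) K)))
    (D : ∀ i, σ i → ℤ × ℤ) (i : ℕ) (j : ℤ) (d : ℤ) :
    Submodule K ↥(Hy (MvPolynomial (Fin m) K) n σ φ (fun i s => (D i s).2) i j) :=
  Submodule.comap
    ((Hy (MvPolynomial (Fin m) K) n σ φ (fun i s => (D i s).2) i j).subtype.restrictScalars K)
    (Submodule.map
      ((LinearMap.range (emap (MvPolynomial (Fin m) K) n (φ i))).mkQ.restrictScalars K)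
      (Submodule.restrictScalars K
          (hKer (MvPolynomial (Fin m) K) n σ φ i ⊓
            ystrand (MvPolynomial (Fin m) K) n (fun s => ((D i s).2 : ℤ)) j) ⊓
        xstrandE K m n (fun s => (D i s).1) d))

end BigradedResolutions

end Paper

open MvPolynomial

namespace PaperAux
section Param
attribute [local instance] MvPolynomial.gradedAlgebra

variable {K : Type} [Field K] {m : ℕ}

lemma isHomog_of_comp {J : Ideal (MvPolynomial (Fin m) K)}
    (hJ : ∀ u ∈ J, ∀ e, homogeneousComponent e u ∈ J) :
    J.IsHomogeneous (homogeneousSubmodule (Fin m) K) := by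
  intro i r hr
  have := hJ r hr i
  rwa [← MvPolynomial.decomposition.decompose'_apply] at this

lemma comp_of_isHomog {J : Ideal (MvPolynomial (Fin m) K)}
    (hJ : J.IsHomogeneous (homogeneousSubmodule (Fin m) K)) :
    ∀ u ∈ J, ∀ e, homogeneousComponent e u ∈ J := by
  intro u hu e
  exact homogeneousComponent_mem_of_mem hJ hu e

lemma minimalPrime_isHomog {J p : Ideal (MvPolynomial (Fin m) K)}
    (hJ : J.IsHomogeneous (homogeneousSubmodule (Fin m) K)) (hp : p ∈ J.minimalPrimes) :
    p.IsHomogeneous (homogeneousSubmodule (Fin m) K) := by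
  have hprime : p.IsPrime := hp.1.1
  have h1 := hprime.homogeneousCore (𝒜 := homogeneousSubmodule (Fin m) K)
  have h2 : J ≤ (p.homogeneousCore (homogeneousSubmodule (Fin m) K)).toIdeal := by
    rw [← hJ.toIdeal_homogeneousCore_eq_self]
    exact Ideal.homogeneousCore_mono _ hp.1.2
  have h3 := hp.2 ⟨h1, h2⟩ (Ideal.toIdeal_homogeneousCore_le _ _)
  rw [Ideal.IsHomogeneous.iff_eq]
  exact le_antisymm (Ideal.toIdeal_homogeneousCore_le _ _) h3

lemma homog_prime_le {p : Ideal (MvPolynomial (Fin m) K)} [hp : p.IsPrime]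
    (hh : p.IsHomogeneous (homogeneousSubmodule (Fin m) K)) :
    p ≤ idealOfVars (Fin m) K := by
  intro u hu
  have h0 := comp_of_isHomog hh u hu 0
  rw [homogeneousComponent_zero] at h0
  have hc : coeff 0 u = 0 := by
    by_contra h
    exact hp.ne_top (Ideal.eq_top_of_isUnit_mem _ h0 ((IsUnit.mk0 _ h).map C))
  have := (mem_pow_idealOfVars_iff' (σ := Fin m) (R := K) 1 u).2 (by
    intro x hx
    have : x = 0 := by
      have : x.degree = 0 := by omega
      exact (Finsupp.degree_eq_zero_iff x).1 this
    rw [this, hc])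
  simpa using this

/-- there is a homogeneous element in `q` not in `p` if `q ≰ p`. -/
lemma exists_homog_of_not_le {p q : Ideal (MvPolynomial (Fin m) K)}
    (hq : q.IsHomogeneous (homogeneousSubmodule (Fin m) K)) (h : ¬ q ≤ p) :
    ∃ e : ℕ, ∃ u : MvPolynomial (Fin m) K, u.IsHomogeneous e ∧ u ∈ q ∧ u ∉ p := by
  obtain ⟨u, hu, hup⟩ := SetLike.not_le_iff_exists.1 h
  by_contra hcon
  push Not at hcon
  apply hup
  rw [← sum_homogeneousComponent u]
  exact Ideal.sum_mem _ fun e _ => hcon e _ (homogeneousComponent_isHomogeneous e u)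
    (comp_of_isHomog hq u hu e)

lemma exists_avoid (S : Finset (Ideal (MvPolynomial (Fin m) K)))
    (hprime : ∀ p ∈ S, p.IsPrime)
    (hhom : ∀ p ∈ S, p.IsHomogeneous (homogeneousSubmodule (Fin m) K))
    (hanti : ∀ p ∈ S, ∀ q ∈ S, p ≤ q → p = q)
    (hm : ∀ p ∈ S, ¬ idealOfVars (Fin m) K ≤ p) :
    ∃ δ : ℕ, 1 ≤ δ ∧ ∃ g : MvPolynomial (Fin m) K, g.IsHomogeneous δ ∧ ∀ p ∈ S, g ∉ p := by
  classical
  induction S using Finset.induction_on with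
  | empty => exact ⟨1, le_rfl, 0, isHomogeneous_zero _ _ _, by simp⟩
  | insert p S hpS ih =>
    obtain ⟨δ, hδ, g, hg, hgS⟩ := ih (fun q hq => hprime q (Finset.mem_insert_of_mem hq))
      (fun q hq => hhom q (Finset.mem_insert_of_mem hq))
      (fun q hq r hr => hanti q (Finset.mem_insert_of_mem hq) r (Finset.mem_insert_of_mem hr))
      (fun q hq => hm q (Finset.mem_insert_of_mem hq))
    by_cases hgp : g ∈ p
    swap
    · refine ⟨δ, hδ, g, hg, ?_⟩
      intro q hq
      rcases Finset.mem_insert.1 hq with rfl | hq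
      · exact hgp
      · exact hgS q hq
    have hpp : p.IsPrime := hprime p (Finset.mem_insert_self _ _)
    -- variable not in p
    have hx : ∃ l, (X l : MvPolynomial (Fin m) K) ∉ p := by
      by_contra hcon
      push Not at hcon
      apply hm p (Finset.mem_insert_self _ _)
      rw [idealOfVars, Ideal.span_le]
      rintro _ ⟨l, rfl⟩
      exact hcon l
    obtain ⟨l, hl⟩ := hx
    have hch : ∀ q : Ideal (MvPolynomial (Fin m) K), ∃ eu : ℕ × MvPolynomial (Fin m) K, q ∈ S →
        (eu.2.IsHomogeneous eu.1 ∧ eu.2 ∈ q ∧ eu.2 ∉ p) := by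
      intro q
      by_cases hq : q ∈ S
      · obtain ⟨e, u, h⟩ := exists_homog_of_not_le (p := p)
          (hhom q (Finset.mem_insert_of_mem hq)) (by
            intro hle
            have := hanti q (Finset.mem_insert_of_mem hq) p (Finset.mem_insert_self _ _) hle
            exact hpS (this ▸ hq))
        exact ⟨(e, u), fun _ => h⟩
      · exact ⟨(0, 0), fun h => absurd h hq⟩
    choose eu heu using hch
    set h : MvPolynomial (Fin m) K := X l * ∏ q ∈ S, (eu q).2 with hh
    set b : ℕ := 1 + ∑ q ∈ S, (eu q).1 with hb
    have hhom' : h.IsHomogeneous b :=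
      (isHomogeneous_X K l).mul (IsHomogeneous.prod S _ _ fun q hq => (heu q hq).1)
    have hhp : h ∉ p := by
      intro hmem
      rcases hpp.mem_or_mem hmem with h1 | h1
      · exact hl h1
      · rw [hpp.prod_mem_iff] at h1
        obtain ⟨q, hq, h2⟩ := h1
        exact (heu q hq).2.2 h2
    have hhS : ∀ q ∈ S, h ∈ q := by
      intro q hq
      apply Ideal.mul_mem_left
      rw [← Finset.mul_prod_erase _ _ hq]
      exact Ideal.mul_mem_right _ _ (heu q hq).2.1
    refine ⟨δ * b, Nat.mul_pos hδ (by omega), g ^ b + h ^ δ, ?_, ?_⟩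
    · refine IsHomogeneous.add (hg.pow b) ?_
      have := hhom'.pow δ
      rwa [mul_comm b δ] at this
    · intro q hq
      rcases Finset.mem_insert.1 hq with rfl | hq
      · intro hmem
        have h1 : g ^ b ∈ q := Ideal.pow_mem_of_mem _ hgp _ (by omega)
        have := (Ideal.add_mem_iff_right _ h1).1 hmem
        exact hhp (hpp.mem_of_pow_mem _ this)
      · intro hmem
        have h1 : h ^ δ ∈ q := Ideal.pow_mem_of_mem _ (hhS q hq) _ (by omega)
        have := (Ideal.add_mem_iff_left _ h1).1 hmem
        exact hgS q hq ((hprime q (Finset.mem_insert_of_mem hq)).mem_of_pow_mem _ this)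

lemma exists_param (J : Ideal (MvPolynomial (Fin m) K))
    (hJ0 : ∀ u ∈ J, ∀ e, homogeneousComponent e u ∈ J)
    (hdim : ringKrullDim (MvPolynomial (Fin m) K ⧸ J) ≤ 1) :
    ∃ δ : ℕ, 1 ≤ δ ∧ ∃ g : MvPolynomial (Fin m) K, g.IsHomogeneous δ ∧
      ∃ N : ℕ, (idealOfVars (Fin m) K) ^ N ≤ J ⊔ Ideal.span {g} := by
  classical
  have hJ := isHomog_of_comp hJ0
  have hfin : J.minimalPrimes.Finite := Ideal.finite_minimalPrimes_of_isNoetherianRing _ J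
  set S : Finset (Ideal (MvPolynomial (Fin m) K)) :=
    hfin.toFinset.filter (fun p => ¬ idealOfVars (Fin m) K ≤ p) with hS
  have hmemS : ∀ p, p ∈ S ↔ p ∈ J.minimalPrimes ∧ ¬ idealOfVars (Fin m) K ≤ p := by
    intro p; simp [hS]
  obtain ⟨δ, hδ, g, hg, hgS⟩ := exists_avoid S
    (fun p hp => ((hmemS p).1 hp).1.1.1)
    (fun p hp => minimalPrime_isHomog hJ ((hmemS p).1 hp).1)
    (fun p hp q hq hpq => le_antisymm hpq (((hmemS q).1 hq).1.2 ((hmemS p).1 hp).1.1 hpq))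
    (fun p hp => ((hmemS p).1 hp).2)
  refine ⟨δ, hδ, g, hg, ?_⟩
  suffices h : idealOfVars (Fin m) K ≤ (J ⊔ Ideal.span {g}).radical by
    exact Ideal.exists_pow_le_of_le_radical_of_fg h (idealOfVars_fg _ _)
  have hJg : (J ⊔ Ideal.span {g}).IsHomogeneous (homogeneousSubmodule (Fin m) K) := by
    refine hJ.sup (Ideal.homogeneous_span _ _ ?_)
    intro x hx
    rw [Set.mem_singleton_iff] at hx
    subst hx
    exact ⟨δ, hg⟩
  rw [← Ideal.sInf_minimalPrimes]
  refine le_sInf fun q hq => ?_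
  have hqp : q.IsPrime := hq.1.1
  have hqh := minimalPrime_isHomog hJg hq
  have hJq : J ≤ q := le_sup_left.trans hq.1.2
  have hgq : g ∈ q := hq.1.2 (Ideal.mem_sup_right (Ideal.mem_span_singleton_self g))
  obtain ⟨p, hp, hpq⟩ := Ideal.exists_minimalPrimes_le hJq
  by_cases hpm : idealOfVars (Fin m) K ≤ p
  · exact hpm.trans hpq
  have hgp : g ∉ p := hgS p ((hmemS p).2 ⟨hp, hpm⟩)
  have hlt : p < q := lt_of_le_of_ne hpq (by rintro rfl; exact hgp hgq)
  by_contra hqm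
  have hlt2 : q < idealOfVars (Fin m) K := lt_of_le_not_ge (homog_prime_le hqh) hqm
  have hmax : (idealOfVars (Fin m) K).IsPrime := by
    have : idealOfVars (Fin m) K = RingHom.ker (constantCoeff (σ := Fin m) (R := K)) := by
      ext u
      have := (mem_pow_idealOfVars_iff' (σ := Fin m) (R := K) 1 u)
      rw [pow_one] at this
      rw [this, RingHom.mem_ker, constantCoeff_eq]
      constructor
      · intro h; exact h 0 (by simp)
      · intro h x hx
        have : x = 0 := by
          have : x.degree = 0 := by omega
          exact (Finsupp.degree_eq_zero_iff x).1 this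
        rw [this, h]
    rw [this]
    exact RingHom.ker_isPrime _
  rw [ringKrullDim_quotient] at hdim
  let a0 : PrimeSpectrum.zeroLocus (R := MvPolynomial (Fin m) K) (J : Set _) :=
    ⟨⟨p, hp.1.1⟩, hp.1.2⟩
  let a1 : PrimeSpectrum.zeroLocus (R := MvPolynomial (Fin m) K) (J : Set _) :=
    ⟨⟨q, hqp⟩, hJq⟩
  let a2 : PrimeSpectrum.zeroLocus (R := MvPolynomial (Fin m) K) (J : Set _) :=
    ⟨⟨idealOfVars (Fin m) K, hmax⟩, hJq.trans hlt2.le⟩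
  have h01 : a0 < a1 := hlt
  have h12 : a1 < a2 := hlt2
  let s : LTSeries (PrimeSpectrum.zeroLocus (R := MvPolynomial (Fin m) K) (J : Set _)) :=
    { length := 2
      toFun := ![a0, a1, a2]
      step := by
        intro i
        fin_cases i
        · exact h01
        · exact h12 }
  have h2 := Order.LTSeries.length_le_krullDim s
  have h3 : s.length = 2 := rfl
  rw [h3] at h2
  have := h2.trans hdim
  exact absurd this (by decide)

end Param
end PaperAux

open MvPolynomial

namespace PaperAux
section Koszul
open Paper

variable {K : Type} [Field K] {m : ℕ}
variable {N : Type} [AddCommGroup N] [Module (MvPolynomial (Fin m) K) N]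

/-- Koszul sign. -/
def sg (k : Fin m) (T : Finset (Fin m)) : ℤ := (-1) ^ (T.filter (fun l => l < k)).card

lemma sg_sq (k : Fin m) (T : Finset (Fin m)) : sg k T * sg k T = 1 := by
  unfold sg
  rw [← mul_pow]; simp

lemma sg_insert_self (k : Fin m) (T : Finset (Fin m)) : sg k (insert k T) = sg k T := by
  unfold sg; rw [Finset.filter_insert]; simp

lemma sg_insert_lt {k l : Fin m} (h : k < l) {T : Finset (Fin m)} (hk : k ∉ T) :
    sg l (insert k T) = - sg l T := by
  unfold sg; rw [Finset.filter_insert, if_pos h, Finset.card_insert_of_notMem (by simp [hk])]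
  ring

lemma sg_insert_gt {k l : Fin m} (h : ¬ k < l) {T : Finset (Fin m)} :
    sg l (insert k T) = sg l T := by
  unfold sg; rw [Finset.filter_insert, if_neg h]

/-- Extension by zero of a Koszul chain to all finite subsets. -/
noncomputable def kext {i : ℕ} (w : {S : Finset (Fin m) // S.card = i} →₀ N)
    (T : Finset (Fin m)) : N :=
  if h : T.card = i then w ⟨T, h⟩ else 0

lemma kext_val {i : ℕ} (w : {S : Finset (Fin m) // S.card = i} →₀ N)
    (T : {S : Finset (Fin m) // S.card = i}) : kext w T.1 = w T := by
  unfold kext; rw [dif_pos T.2]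

lemma kosD_apply {i : ℕ} (w : {S : Finset (Fin m) // S.card = i + 1} →₀ N)
    (T : {S : Finset (Fin m) // S.card = i}) :
    kosD K m N i w T = ∑ k ∈ Finset.univ.filter (fun k => k ∉ T.1),
      sg k T.1 • ((X k : MvPolynomial (Fin m) K) • kext w (insert k T.1)) := by
  classical
  induction w using Finsupp.induction_linear with
  | zero => simp [kext]
  | add f g hf hg =>
    rw [map_add, Finsupp.add_apply, hf, hg, ← Finset.sum_add_distrib]
    refine Finset.sum_congr rfl fun k _ => ?_
    have : kext (f + g) (insert k T.1) = kext f (insert k T.1) + kext g (insert k T.1) := by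
      unfold kext; split_ifs <;> simp
    rw [this, smul_add, smul_add]
  | single S v =>
    have h1 : kosD K m N i (Finsupp.single S v) T =
        ∑ k : Fin m, if k ∈ S.1 ∧ S.1.erase k = T.1 then
          sg k S.1 • ((X k : MvPolynomial (Fin m) K) • v) else 0 := by
      unfold kosD
      rw [Finsupp.lsum_single, LinearMap.sum_apply, Finsupp.finsetSum_apply]
      have h2 := Finset.sum_attach S.1 (fun l => if S.1.erase l = T.1 then
          sg l S.1 • ((X l : MvPolynomial (Fin m) K) • v) else 0)
      refine Eq.trans (Eq.trans ?_ h2) ?_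
      · refine Finset.sum_congr rfl fun l _ => ?_
        simp only [LinearMap.smul_apply, LinearMap.comp_apply, Finsupp.lsingle_apply,
          Finsupp.smul_apply, LinearMap.lsmul_apply, Finsupp.single_apply, Subtype.ext_iff]
        split_ifs <;> simp [sg]
      · rw [← Finset.sum_filter_add_sum_filter_not Finset.univ (fun k => k ∈ S.1)]
        rw [Finset.sum_eq_zero (s := Finset.univ.filter (fun k => ¬ k ∈ S.1)), add_zero]
        · have : Finset.univ.filter (fun k => k ∈ S.1) = S.1 := by ext; simp
          rw [this]
          refine Finset.sum_congr rfl fun k hk => ?_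
          simp [hk]
        · intro k hk
          rw [if_neg]; intro h; exact (Finset.mem_filter.1 hk).2 h.1
    rw [h1, Finset.sum_filter]
    refine Finset.sum_congr rfl fun k _ => ?_
    by_cases hk : k ∈ S.1 ∧ S.1.erase k = T.1
    · have hkT : k ∉ T.1 := by rw [← hk.2]; simp
      have hins : insert k T.1 = S.1 := by rw [← hk.2, Finset.insert_erase hk.1]
      rw [if_pos hk, if_pos hkT, hins, kext_val, Finsupp.single_eq_same, ← hins, sg_insert_self]
    · rw [if_neg hk]
      by_cases hkT : k ∈ T.1
      · rw [if_neg (by simpa using hkT)]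
      · have : kext (Finsupp.single S v) (insert k T.1) = 0 := by
          unfold kext
          split_ifs with hc
          · rw [Finsupp.single_apply, if_neg]
            intro h
            apply hk
            have : S.1 = insert k T.1 := by rw [h]
            rw [this]
            exact ⟨by simp, by rw [Finset.erase_insert hkT]⟩
          · rfl
        rw [this]; simp

lemma X_smul_mem_range {i : ℕ} (l : Fin m) (z : {S : Finset (Fin m) // S.card = i} →₀ N)
    (hz : z ∈ kosKer K m N i) :
    (X l : MvPolynomial (Fin m) K) • z ∈ LinearMap.range (kosD K m N i) := by
  classical
  refine ⟨Finsupp.equivFunOnFinite.symm fun S => if l ∈ S.1 then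
    sg l S.1 • kext z (S.1.erase l) else 0, ?_⟩
  ext T
  rw [kosD_apply, Finsupp.smul_apply]
  have hk : ∀ k ∉ T.1, kext (Finsupp.equivFunOnFinite.symm
      fun S : {S : Finset (Fin m) // S.card = i + 1} => if l ∈ S.1 then
      sg l S.1 • kext z (S.1.erase l) else 0) (insert k T.1) =
      if l ∈ insert k T.1 then
      sg l (insert k T.1) • kext z ((insert k T.1).erase l) else 0 := by
    intro k hk
    rw [kext, dif_pos (by rw [Finset.card_insert_of_notMem hk, T.2])]
    rfl
  by_cases hlT : l ∈ T.1
  · -- use the cycle condition at `T.erase l`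
    have hTc := T.2
    obtain ⟨i, rfl⟩ : ∃ i', i = i' + 1 := by
      refine ⟨i - 1, ?_⟩
      have := Finset.card_pos.2 ⟨l, hlT⟩
      omega
    have hz' : kosD K m N i z = 0 := hz
    have h0 := DFunLike.congr_fun hz' ⟨T.1.erase l, by
      rw [Finset.card_erase_of_mem hlT, hTc]; rfl⟩
    rw [kosD_apply, Finsupp.zero_apply] at h0
    have hs : Finset.univ.filter (fun k => k ∉ T.1.erase l) =
        insert l (Finset.univ.filter (fun k => k ∉ T.1)) := by
      ext k
      by_cases hkl : k = l <;> simp [hkl]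
    simp only at h0
    rw [hs, Finset.sum_insert (by simp [hlT]), Finset.insert_erase hlT, kext_val] at h0
    have h0' := congrArg (fun v => sg l (T.1.erase l) • v) h0
    simp only [smul_add, smul_zero, ← mul_smul, sg_sq, one_smul] at h0'
    rw [Finset.smul_sum] at h0'
    rw [← sub_eq_zero, ← neg_eq_zero, neg_sub, sub_eq_add_neg, ← Finset.sum_neg_distrib]
    refine Eq.trans ?_ h0'
    congr 1
    refine Finset.sum_congr rfl fun k hkm => ?_
    have hkT : k ∉ T.1 := (Finset.mem_filter.1 hkm).2
    rw [hk k hkT, if_pos (by simp [hlT])]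
    have hkl : k ≠ l := by rintro rfl; exact hkT hlT
    rw [Finset.erase_insert_of_ne hkl, smul_comm (X k : MvPolynomial (Fin m) K) (sg l _),
      ← mul_smul, ← neg_smul, ← mul_smul]
    congr 1
    have hT : T.1 = insert l (T.1.erase l) := (Finset.insert_erase hlT).symm
    generalize hU : T.1.erase l = U at hT
    have hlU : l ∉ U := by rw [← hU]; simp
    have hkU : k ∉ U := by rw [← hU]; simp [hkT]
    rw [hT]
    rcases lt_or_gt_of_ne hkl with h | h
    · rw [sg_insert_gt (k := l) (l := k) (by exact not_lt.2 h.le),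
        sg_insert_lt (k := k) (l := l) h (by simp [hkl, hkU]), sg_insert_self]
      ring
    · rw [sg_insert_lt (k := l) (l := k) h hlU,
        sg_insert_gt (k := k) (l := l) (by exact not_lt.2 h.le), sg_insert_self]
      ring
  · rw [Finset.sum_eq_single l]
    · rw [hk l hlT, if_pos (by simp), Finset.erase_insert hlT, kext_val, sg_insert_self,
        smul_comm (X l : MvPolynomial (Fin m) K) (sg l _), ← mul_smul, sg_sq, one_smul]
    · intro k hkm hkl
      have hkT : k ∉ T.1 := (Finset.mem_filter.1 hkm).2
      rw [hk k hkT, if_neg (by simp [hlT, Ne.symm hkl]), smul_zero, smul_zero]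
    · intro h; simp [hlT] at h

lemma smul_mem_kos_range {i : ℕ} {g : MvPolynomial (Fin m) K}
    (hg : g ∈ idealOfVars (Fin m) K) (z : {S : Finset (Fin m) // S.card = i} →₀ N)
    (hz : z ∈ kosKer K m N i) : g • z ∈ LinearMap.range (kosD K m N i) := by
  rw [idealOfVars] at hg
  induction hg using Submodule.span_induction with
  | mem x hx => obtain ⟨l, rfl⟩ := hx; exact X_smul_mem_range l z hz
  | zero => simp
  | add x y _ _ hx hy => rw [add_smul]; exact add_mem hx hy
  | smul a x _ hx => rw [smul_assoc]; exact Submodule.smul_mem _ _ hx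

variable [Module K N] [IsScalarTower K (MvPolynomial (Fin m) K) N]

/-- The abstract Koszul argument for the upper bound. -/
lemma kos_upper (ℬ : ℤ → Submodule K N) (δ : ℕ) (g : MvPolynomial (Fin m) K)
    (hg : g ∈ idealOfVars (Fin m) K) (B : ℤ)
    (hX : ∀ k e, ∀ v ∈ ℬ e, (X k : MvPolynomial (Fin m) K) • v ∈ ℬ (e + 1))
    (hsurj : ∀ e, B ≤ e → ∀ v ∈ ℬ e, ∃ w ∈ ℬ (e - δ), g • w = v)
    (hinj : ∀ e, B ≤ e → ∀ v ∈ ℬ e, g • v = 0 → v = 0)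
    (e : ℤ) (he : ∃ i : ℕ,
      Submodule.map ((LinearMap.range (kosD K m N i)).mkQ.restrictScalars K)
      (kosStrand K m N ℬ i (e + i) ⊓ (kosKer K m N i).restrictScalars K) ≠ ⊥) :
    e ≤ B + δ := by
  classical
  by_contra hlt
  push Not at hlt
  obtain ⟨i, hi⟩ := he
  apply hi
  rw [eq_bot_iff]
  rintro _ ⟨z, ⟨hz1, hz2⟩, rfl⟩
  have hz1' : ∀ S, z S ∈ ℬ e := by
    intro S
    have := hz1 S
    simpa using this
  choose w hw hgw using fun S => hsurj e (by omega) (z S) (hz1' S)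
  set w' : {S : Finset (Fin m) // S.card = i} →₀ N := Finsupp.equivFunOnFinite.symm w with hw'
  have hzw : z = g • w' := by
    ext S
    rw [Finsupp.smul_apply]
    exact (hgw S).symm
  have hker : w' ∈ kosKer K m N i := by
    cases i with
    | zero => exact Submodule.mem_top
    | succ i =>
      change kosD K m N i w' = 0
      have hz3 : kosD K m N i z = 0 := hz2
      ext T
      refine hinj (e - δ + 1) (by omega) _ ?_ ?_
      · rw [kosD_apply]
        refine Submodule.sum_mem _ fun k hk => ?_
        refine zsmul_mem (hX _ _ _ ?_) _
        rw [kext]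
        split_ifs
        · exact hw _
        · exact zero_mem _
      · rw [hzw, map_smul] at hz3
        have := DFunLike.congr_fun hz3 T
        simpa using this
  have : z ∈ LinearMap.range (kosD K m N i) := by
    rw [hzw]; exact smul_mem_kos_range hg w' hker
  simpa using this

/-- The abstract Koszul argument for the lower bound. -/
lemma kos_lower (ℬ : ℤ → Submodule K N) (π : ℤ → N →+ N)
    (hπ : ∀ e v, v ∈ ℬ e → π e v = v)
    (hπm : ∀ e v, π e v ∈ ℬ e)
    (hX : ∀ k e v, π e ((X k : MvPolynomial (Fin m) K) • v) =
      (X k : MvPolynomial (Fin m) K) • π (e - 1) v)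
    (e : ℤ) (h0 : ℬ (e - 1) = ⊥) (h1 : ℬ e ≠ ⊥) :
    ∃ i : ℕ,
      Submodule.map ((LinearMap.range (kosD K m N i)).mkQ.restrictScalars K)
      (kosStrand K m N ℬ i (e + i) ⊓ (kosKer K m N i).restrictScalars K) ≠ ⊥ := by
  classical
  refine ⟨0, fun hbot => ?_⟩
  obtain ⟨v, hv, hv0⟩ := (Submodule.ne_bot_iff _).1 h1
  apply hv0
  set E : {S : Finset (Fin m) // S.card = 0} := ⟨∅, rfl⟩ with hE
  have hmem : Finsupp.single E v ∈ LinearMap.range (kosD K m N 0) := by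
    have h2 : ((LinearMap.range (kosD K m N 0)).mkQ.restrictScalars K) (Finsupp.single E v) ∈
      Submodule.map ((LinearMap.range (kosD K m N 0)).mkQ.restrictScalars K)
      (kosStrand K m N ℬ 0 (e + (0 : ℕ)) ⊓ (kosKer K m N 0).restrictScalars K) := by
      refine ⟨_, ⟨?_, Submodule.mem_top⟩, rfl⟩
      intro S
      rw [Finsupp.single_apply]
      split_ifs
      · simpa using hv
      · exact zero_mem _
    rw [hbot] at h2
    simpa using h2
  obtain ⟨w, hw⟩ := hmem
  have h3 := DFunLike.congr_fun hw E
  rw [kosD_apply, Finsupp.single_eq_same] at h3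
  rw [← hπ e v hv, ← h3, map_sum]
  refine Finset.sum_eq_zero fun k _ => ?_
  rw [map_zsmul, hX]
  have : π (e - 1) (kext w (insert k E.1)) = 0 := by
    have := hπm (e - 1) (kext w (insert k E.1))
    rw [h0] at this
    simpa using this
  rw [this]; simp

end Koszul
end PaperAux

open MvPolynomial

namespace PaperAux
open Paper

section Proj
variable {K : Type} [Field K] {m n : ℕ}

lemma tdeg_eq {n : ℕ} (c : Fin n →₀ ℕ) : tdeg c = c.degree := rfl

/-- Keep the terms of a polynomial whose exponent satisfies `Q`. -/
noncomputable def prA (Q : (Fin m →₀ ℕ) → Prop) :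
    MvPolynomial (Fin m) K →+ MvPolynomial (Fin m) K := by
  classical
  exact
  { toFun := fun p => ∑ ν ∈ p.support.filter Q, monomial ν (coeff ν p)
    map_zero' := by simp
    map_add' := by
      intro p q
      ext ν
      simp only [coeff_add, coeff_sum, coeff_monomial, Finset.sum_ite_eq', Finset.mem_filter,
        mem_support_iff]
      by_cases hQ : Q ν <;> by_cases h1 : coeff ν p = 0 <;> by_cases h2 : coeff ν q = 0 <;>
        by_cases h3 : coeff ν p + coeff ν q = 0 <;> simp_all }

open scoped Classical in
lemma coeff_prA (Q : (Fin m →₀ ℕ) → Prop) (p : MvPolynomial (Fin m) K) (ν) :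
    coeff ν (prA Q p) = if Q ν then coeff ν p else 0 := by
  unfold prA
  simp only [AddMonoidHom.coe_mk, ZeroHom.coe_mk, coeff_sum, coeff_monomial, Finset.sum_ite_eq',
    Finset.mem_filter, mem_support_iff]
  by_cases hQ : Q ν <;> by_cases h1 : coeff ν p = 0 <;> simp_all

/-- additive weights on pairs of exponents -/
abbrev Wt (m n : ℕ) := ((Fin n →₀ ℕ) × (Fin m →₀ ℕ)) →+ ℤ

/-- the `x`-degree -/
noncomputable def wx (m n : ℕ) : Wt m n where
  toFun := fun p => (p.2.degree : ℤ)
  map_zero' := by simp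
  map_add' := by intro a b; simp

/-- the `y`-degree -/
noncomputable def wy (m n : ℕ) : Wt m n where
  toFun := fun p => (p.1.degree : ℤ)
  map_zero' := by simp
  map_add' := by intro a b; simp

lemma wx_apply (β : Fin n →₀ ℕ) (ν : Fin m →₀ ℕ) : wx m n (β, ν) = (tdeg ν : ℤ) := rfl
lemma wy_apply (β : Fin n →₀ ℕ) (ν : Fin m →₀ ℕ) : wy m n (β, ν) = (tdeg β : ℤ) := rfl

abbrev PP (K : Type) [Field K] (m n : ℕ) := MvPolynomial (Fin n) (MvPolynomial (Fin m) K)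

/-- the weight-`d` part of an element of `P`. -/
noncomputable def prP (w : Wt m n) (d : ℤ) : PP K m n →+ PP K m n where
  toFun := fun p => ∑ β ∈ p.support, monomial β (prA (fun ν => w (β, ν) = d) (coeff β p))
  map_zero' := by simp
  map_add' := by
    classical
    intro p q
    ext1 β
    have key : ∀ p : PP K m n, coeff β (∑ β ∈ p.support,
        monomial β (prA (fun ν => w (β, ν) = d) (coeff β p))) =
        prA (fun ν => w (β, ν) = d) (coeff β p) := by
      intro p
      simp only [coeff_sum, coeff_monomial, Finset.sum_ite_eq', mem_support_iff]
      by_cases h1 : coeff β p = 0 <;> simp [h1]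
    rw [coeff_add, key, key, key, coeff_add, map_add]

lemma coeff_prP' (w : Wt m n) (d : ℤ) (p : PP K m n) (β) :
    coeff β (prP w d p) = prA (fun ν => w (β, ν) = d) (coeff β p) := by
  classical
  unfold prP
  simp only [AddMonoidHom.coe_mk, ZeroHom.coe_mk, coeff_sum, coeff_monomial, Finset.sum_ite_eq',
    mem_support_iff]
  by_cases h1 : coeff β p = 0 <;> simp_all

lemma coeff_prP (w : Wt m n) (d : ℤ) (p : PP K m n) (β ν) :
    coeff ν (coeff β (prP w d p)) = if w (β, ν) = d then coeff ν (coeff β p) else 0 := by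
  classical
  rw [coeff_prP', coeff_prA]
  congr

/-- all terms of `q` have weight `δ`. -/
def IsWt (w : Wt m n) (δ : ℤ) (q : PP K m n) : Prop :=
  ∀ β ν, coeff ν (coeff β q) ≠ 0 → w (β, ν) = δ

lemma coeff2_mul (p q : PP K m n) (β ν) : coeff ν (coeff β (p * q)) =
    ∑ x ∈ Finset.HasAntidiagonal.antidiagonal β, ∑ y ∈ Finset.HasAntidiagonal.antidiagonal ν,
      coeff y.1 (coeff x.1 p) * coeff y.2 (coeff x.2 q) := by
  rw [coeff_mul, coeff_sum]
  refine Finset.sum_congr rfl fun x _ => ?_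
  rw [coeff_mul]

lemma prP_mul (w : Wt m n) (d δ : ℤ) (p q : PP K m n) (hq : IsWt w δ q) :
    prP w d (p * q) = prP w (d - δ) p * q := by
  ext β ν
  rw [coeff_prP, coeff2_mul, coeff2_mul]
  have key : ∀ x ∈ Finset.HasAntidiagonal.antidiagonal β,
      ∀ y ∈ Finset.HasAntidiagonal.antidiagonal ν,
      coeff y.1 (coeff x.1 (prP w (d - δ) p)) * coeff y.2 (coeff x.2 q) =
      if w (β, ν) = d then coeff y.1 (coeff x.1 p) * coeff y.2 (coeff x.2 q) else 0 := by
    intro x hx y hy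
    rw [Finset.HasAntidiagonal.mem_antidiagonal] at hx hy
    by_cases h : coeff y.2 (coeff x.2 q) = 0
    · simp [h]
    · have h1 := hq _ _ h
      have h2 : w (β, ν) = w (x.1, y.1) + w (x.2, y.2) := by
        rw [← map_add, Prod.mk_add_mk, hx, hy]
      rw [coeff_prP]
      have : (w (x.1, y.1) = d - δ) ↔ w (β, ν) = d := by omega
      simp only [this]
      split_ifs <;> simp
  rw [Finset.sum_congr rfl fun x hx => Finset.sum_congr rfl fun y hy => key x hx y hy]
  split_ifs <;> simp

lemma prP_idem (w : Wt m n) (d : ℤ) (p : PP K m n) : prP w d (prP w d p) = prP w d p := by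
  ext β ν
  simp only [coeff_prP]; split_ifs <;> rfl

lemma prP_of_isWt (w : Wt m n) (d : ℤ) (p : PP K m n) (h : IsWt w d p) : prP w d p = p := by
  ext β ν
  rw [coeff_prP]; split_ifs with h1
  · rfl
  · by_contra h2; exact h1 (h _ _ (Ne.symm h2))

lemma isWt_prP (w : Wt m n) (d : ℤ) (p : PP K m n) : IsWt w d (prP w d p) := by
  intro β ν h
  rw [coeff_prP] at h
  by_contra h2; simp [h2] at h

lemma prP_of_isWt_ne (w : Wt m n) (d d' : ℤ) (p : PP K m n) (h : IsWt w d p) (hd : d ≠ d') :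
    prP w d' p = 0 := by
  ext β ν
  rw [coeff_prP]; split_ifs with h1
  · by_contra h2; exact hd ((h _ _ (by simpa using h2)).symm.trans h1)
  · simp

lemma exists_prP_sum (w : Wt m n) (p : PP K m n) : ∃ S : Finset ℤ, ∀ T : Finset ℤ, S ⊆ T →
    ∑ d ∈ T, prP w d p = p := by
  classical
  refine ⟨p.support.biUnion fun β => (coeff β p).support.image fun ν => w (β, ν), ?_⟩
  intro T hT
  ext β ν
  simp only [coeff_sum, coeff_prP, Finset.sum_ite_eq]
  split_ifs with h
  · rfl
  · by_contra h2
    apply h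
    apply hT
    rw [Finset.mem_biUnion]
    refine ⟨β, ?_, ?_⟩
    · rw [mem_support_iff]; intro h3; simp [h3] at h2
    · rw [Finset.mem_image]; exact ⟨ν, by rw [mem_support_iff]; exact Ne.symm h2, rfl⟩

end Proj

section FProj
variable {K : Type} [Field K] {m n : ℕ} {σ τ : Type}

/-- weight-`d` part on a free module with twists `a`. -/
noncomputable def pr (w : Wt m n) (a : σ → ℤ) (d : ℤ) :
    (σ →₀ PP K m n) →+ (σ →₀ PP K m n) where
  toFun := fun f => Finsupp.onFinset f.support (fun s => prP w (d - a s) (f s)) (by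
    intro s hs; rw [Finsupp.mem_support_iff]; intro h; exact hs (by simp [h]))
  map_zero' := by ext1 s; simp
  map_add' := by intro f g; ext1 s; simp

lemma pr_apply (w : Wt m n) (a : σ → ℤ) (d : ℤ) (f : σ →₀ PP K m n) (s : σ) :
    pr w a d f s = prP w (d - a s) (f s) := rfl

lemma pr_idem (w : Wt m n) (a : σ → ℤ) (d : ℤ) (f : σ →₀ PP K m n) :
    pr w a d (pr w a d f) = pr w a d f := by
  ext1 s; simp only [pr_apply, prP_idem]

lemma pr_smul (w : Wt m n) (a : σ → ℤ) (d δ : ℤ) (q : PP K m n) (hq : IsWt w δ q)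
    (f : σ →₀ PP K m n) : pr w a d (q • f) = q • pr w a (d - δ) f := by
  ext1 s
  rw [pr_apply, Finsupp.smul_apply, Finsupp.smul_apply, pr_apply, smul_eq_mul, smul_eq_mul,
    mul_comm, prP_mul _ _ _ _ _ hq, mul_comm]
  congr 2; ring_nf

lemma pr_single (w : Wt m n) (a : σ → ℤ) (d : ℤ) (s : σ) (p : PP K m n) :
    pr w a d (Finsupp.single s p) = Finsupp.single s (prP w (d - a s) p) := by
  classical
  ext1 t
  rw [pr_apply, Finsupp.single_apply, Finsupp.single_apply]
  split_ifs with h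
  · rw [h]
  · simp

/-- `φ` is graded with respect to `w` with source twists `a'` and target twists `a`. -/
def IsGr (w : Wt m n) (a' : τ → ℤ) (a : σ → ℤ)
    (φ : (τ →₀ PP K m n) →ₗ[PP K m n] (σ →₀ PP K m n)) : Prop :=
  ∀ t s, IsWt w (a' t - a s) (φ (Finsupp.single t 1) s)

lemma pr_comm (w : Wt m n) (a' : τ → ℤ) (a : σ → ℤ)
    (φ : (τ →₀ PP K m n) →ₗ[PP K m n] (σ →₀ PP K m n)) (h : IsGr w a' a φ) (d : ℤ)
    (f : τ →₀ PP K m n) : pr w a d (φ f) = φ (pr w a' d f) := by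
  induction f using Finsupp.induction_linear with
  | zero => simp
  | add f g hf hg => rw [map_add, map_add, hf, hg, map_add, map_add]
  | single t p =>
    have h1 : ∀ p : PP K m n, φ (Finsupp.single t p) = p • φ (Finsupp.single t 1) := by
      intro p; rw [← map_smul, Finsupp.smul_single, smul_eq_mul, mul_one]
    rw [pr_single, h1, h1 (prP _ _ _)]
    ext1 s
    rw [pr_apply, Finsupp.smul_apply, Finsupp.smul_apply, smul_eq_mul, smul_eq_mul,
      prP_mul _ _ _ _ _ (h t s)]
    congr 2; ring_nf

lemma exists_pr_sum [Finite σ] (w : Wt m n) (a : σ → ℤ) (f : σ →₀ PP K m n) :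
    ∃ T : Finset ℤ, ∑ d ∈ T, pr w a d f = f := by
  classical
  cases nonempty_fintype σ
  choose S hS using fun s => exists_prP_sum w (f s)
  refine ⟨Finset.univ.biUnion fun s => (S s).image (· + a s), ?_⟩
  ext1 s
  rw [Finsupp.finsetSum_apply]
  simp only [pr_apply]
  rw [← Finset.sum_image (f := fun e => prP w e (f s)) (g := fun d => d - a s)
    (by intro x _ y _ hxy; simpa using hxy)]
  apply hS
  intro e he
  rw [Finset.mem_image]
  refine ⟨e + a s, ?_, by ring⟩
  rw [Finset.mem_biUnion]
  exact ⟨s, Finset.mem_univ _, Finset.mem_image_of_mem _ he⟩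

end FProj

section RStruct
variable {K : Type} [Field K] {m n : ℕ} {σ τ : Type}

/-- `K[y]` -/
abbrev RR (K : Type) [Field K] (n : ℕ) := MvPolynomial (Fin n) K

noncomputable abbrev algRP (K : Type) [Field K] (m n : ℕ) : Algebra (RR K n) (PP K m n) :=
  MvPolynomial.algebraMvPolynomial

attribute [local instance] algRP

lemma free_RP : Module.Free (RR K n) (PP K m n) := by
  have : Algebra.IsPushout K (RR K n) (MvPolynomial (Fin m) K) (PP K m n) := inferInstance
  exact this.out.free

lemma X_smul_R (l : Fin n) (k : ℕ) (p : PP K m n) :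
    ((X l : RR K n) ^ k) • p = (X l : PP K m n) ^ k * p := by
  rw [Algebra.smul_def, map_pow]; simp

lemma isWt_wx_R (r : RR K n) : IsWt (wx m n) 0 (algebraMap (RR K n) (PP K m n) r) := by
  classical
  intro β ν h
  have : coeff β (algebraMap (RR K n) (PP K m n) r) = C (coeff β r) := by
    change coeff β (MvPolynomial.map _ r) = _
    rw [coeff_map]; rfl
  rw [this, coeff_C] at h
  have h2 : ν = 0 := by by_contra h3; simp [Ne.symm h3] at h
  rw [h2]; simp [wx_apply, tdeg]

end RStruct
end PaperAux

open MvPolynomial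

namespace PaperAux
open Paper

section EProj
variable {K : Type} [Field K] {m n : ℕ} {σ τ : Type}

/-- `E_σ` -/
abbrev EE (K : Type) [Field K] (m n : ℕ) (σ : Type) := Emod (MvPolynomial (Fin m) K) n σ

/-- weight-`d` part of `E_σ`. -/
noncomputable def prE (w : Wt m n) (a : σ → ℤ) (d : ℤ) : EE K m n σ →+ EE K m n σ where
  toFun := fun z => Finsupp.onFinset z.support
    (fun x => prA (fun ν => w (x.2, ν) = d - a x.1) (z x)) (by
    intro s hs; rw [Finsupp.mem_support_iff]; intro h; exact hs (by simp [h]))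
  map_zero' := by ext1 s; simp
  map_add' := by intro f g; ext1 s; simp

lemma prE_apply (w : Wt m n) (a : σ → ℤ) (d : ℤ) (z : EE K m n σ) (s : σ) (c) (ν) :
    coeff ν (prE w a d z (s, c)) = if w (c, ν) = d - a s then coeff ν (z (s, c)) else 0 := by
  classical
  change coeff ν (prA _ _) = _
  rw [coeff_prA]; congr

/-- the weight strand -/
def InE (w : Wt m n) (a : σ → ℤ) (d : ℤ) (z : EE K m n σ) : Prop :=
  ∀ s c ν, coeff ν (z (s, c)) ≠ 0 → w (c, ν) = d - a s

lemma inE_prE (w : Wt m n) (a : σ → ℤ) (d : ℤ) (z : EE K m n σ) : InE w a d (prE w a d z) := by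
  intro s c ν h
  rw [prE_apply] at h
  by_contra h2; simp [h2] at h

lemma prE_of_inE (w : Wt m n) (a : σ → ℤ) (d : ℤ) (z : EE K m n σ) (h : InE w a d z) :
    prE w a d z = z := by
  ext ⟨s, c⟩ ν
  rw [prE_apply]; split_ifs with h1
  · rfl
  · by_contra h2; exact h1 (h _ _ _ (Ne.symm h2))

lemma inE_prE_of_inE (w w' : Wt m n) (a a' : σ → ℤ) (d d' : ℤ) (z : EE K m n σ)
    (h : InE w' a' d' z) : InE w' a' d' (prE w a d z) := by
  intro s c ν h1
  apply h
  rw [prE_apply] at h1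
  intro h2; simp [h2] at h1

lemma mem_xstrandE_iff (a : σ → ℤ) (d : ℤ) (z : EE K m n σ) :
    z ∈ xstrandE K m n a d ↔ InE (wx m n) a d z := Iff.rfl

lemma mem_ystrand_iff (b : σ → ℤ) (j : ℤ) (z : EE K m n σ) :
    z ∈ ystrand (MvPolynomial (Fin m) K) n b j ↔ InE (-wy m n) b (j + n) z := by
  constructor
  · intro h s c ν h1
    have := h s c (by intro h2; simp [h2] at h1)
    rw [AddMonoidHom.neg_apply, wy_apply]; omega
  · intro h s c h1
    obtain ⟨ν, hν⟩ := MvPolynomial.ne_zero_iff.1 h1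
    have := h s c ν hν
    rw [AddMonoidHom.neg_apply, wy_apply] at this; omega

/-- the truncation map `F_σ → E_σ` -/
noncomputable def rho (t : Fin n →₀ ℕ) : (σ →₀ PP K m n) →+ EE K m n σ where
  toFun := fun f => Finsupp.onFinset (f.support ×ˢ Finset.Icc 0 t)
    (fun x => if x.2 ≤ t then coeff (t - x.2) (f x.1) else 0) (by
      intro x hx
      rw [Finset.mem_product, Finsupp.mem_support_iff, Finset.mem_Icc]
      refine ⟨?_, zero_le, ?_⟩
      · intro h; simp [h] at hx
      · by_contra h; simp [h] at hx)
  map_zero' := by ext1 s; simp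
  map_add' := by intro f g; ext1 s; simp; split_ifs <;> simp

lemma rho_apply (t : Fin n →₀ ℕ) (f : σ →₀ PP K m n) (s : σ) (c) :
    rho t f (s, c) = if c ≤ t then coeff (t - c) (f s) else 0 := rfl

lemma rho_smul (t : Fin n →₀ ℕ) (g : MvPolynomial (Fin m) K) (f : σ →₀ PP K m n) :
    rho t ((C g : PP K m n) • f) = g • rho t f := by
  ext1 ⟨s, c⟩
  rw [Finsupp.smul_apply, rho_apply, rho_apply, Finsupp.smul_apply, smul_eq_mul, coeff_C_mul]
  split_ifs <;> simp

lemma rho_prE (w w' : Wt m n) (a : σ → ℤ) (d e : ℤ) (t : Fin n →₀ ℕ)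
    (h : ∀ c ≤ t, ∀ ν, w (t - c, ν) = w' (c, ν) + e) (f : σ →₀ PP K m n) :
    prE w' a d (rho t f) = rho t (pr w a (d + e) f) := by
  ext ⟨s, c⟩ ν
  rw [prE_apply, rho_apply, rho_apply]
  by_cases hc : c ≤ t
  · rw [if_pos hc, if_pos hc, pr_apply, coeff_prP, h c hc]
    have : w' (c, ν) = d - a s ↔ w' (c, ν) + e = d + e - a s := by omega
    simp only [this]
  · simp [hc]

lemma rho_prE_x (a : σ → ℤ) (d : ℤ) (t : Fin n →₀ ℕ) (f : σ →₀ PP K m n) :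
    prE (wx m n) a d (rho t f) = rho t (pr (wx m n) a d f) := by
  rw [rho_prE (wx m n) (wx m n) a d 0 t, add_zero]
  intro c _ ν; simp [wx_apply]

lemma rho_prE_y (a : σ → ℤ) (d : ℤ) (t : Fin n →₀ ℕ) (f : σ →₀ PP K m n) :
    prE (-wy m n) a d (rho t f) = rho t (pr (wy m n) a (d + tdeg t) f) := by
  apply rho_prE
  intro c hc ν
  rw [AddMonoidHom.neg_apply, wy_apply, wy_apply]
  have : tdeg (t - c) + tdeg c = tdeg t := by
    rw [tdeg_eq, tdeg_eq, tdeg_eq, ← map_add, tsub_add_cancel_of_le hc]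
  omega

lemma rho_single (t : Fin n →₀ ℕ) (s : σ) (β) (a : MvPolynomial (Fin m) K) :
    rho t (Finsupp.single s (monomial β a)) =
      if β ≤ t then Finsupp.single (s, t - β) a else (0 : EE K m n σ) := by
  classical
  ext1 ⟨s', c⟩
  rw [rho_apply]
  by_cases hs : s = s'
  · subst hs
    rw [Finsupp.single_eq_same, coeff_monomial]
    by_cases hβ : β ≤ t
    · rw [if_pos hβ, Finsupp.single_apply]
      by_cases hc : c ≤ t
      · have : β = t - c ↔ (s, t - β) = (s, c) := by
          rw [Prod.mk_right_inj]
          constructor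
          · rintro rfl; exact tsub_tsub_cancel_of_le hc
          · rintro rfl; exact (tsub_tsub_cancel_of_le hβ).symm
        simp only [hc, if_true, this]
      · rw [if_neg hc, if_neg]
        rw [Prod.mk_right_inj]
        rintro rfl; exact hc tsub_le_self
    · rw [if_neg hβ]
      split_ifs with h1 h2
      · exact absurd (h2 ▸ tsub_le_self) hβ
      · rfl
      · rfl
  · rw [Finsupp.single_eq_of_ne (Ne.symm hs)]
    have : (s, t - β) ≠ (s', c) := by simp [hs]
    split_ifs
    · rw [Finsupp.single_eq_of_ne this.symm]; simp
    · simp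
    · rw [Finsupp.single_eq_of_ne this.symm]
    · simp

lemma contract_single (f : PP K m n) (c c' : Fin n →₀ ℕ) :
    contract (MvPolynomial (Fin m) K) n f (Finsupp.single c 1) c' =
      if c' ≤ c then coeff (c - c') f else 0 := by
  classical
  unfold contract
  rw [Finsupp.lsum_single, LinearMap.smulRight_apply, LinearMap.id_apply, one_smul,
    Finsupp.finsetSum_apply]
  by_cases hc : c' ≤ c
  · rw [if_pos hc, Finset.sum_eq_single (c - c')]
    · rw [if_pos tsub_le_self, tsub_tsub_cancel_of_le hc, Finsupp.single_eq_same]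
    · intro β _ hβ
      split_ifs with h
      · rw [Finsupp.single_eq_of_ne]
        rintro rfl
        exact hβ (tsub_tsub_cancel_of_le h).symm
      · rfl
    · intro h
      rw [notMem_support_iff] at h
      simp [h]
  · rw [if_neg hc]
    apply Finset.sum_eq_zero
    intro β _
    split_ifs with h
    · rw [Finsupp.single_eq_of_ne]
      rintro rfl
      exact hc tsub_le_self
    · rfl

lemma emap_single (φ : (τ →₀ PP K m n) →ₗ[PP K m n] (σ →₀ PP K m n)) (t : τ) (c a) (s : σ) (c') :
    emap (MvPolynomial (Fin m) K) n φ (Finsupp.single (t, c) a) (s, c') =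
      a * if c' ≤ c then coeff (c - c') (φ (Finsupp.single t 1) s) else 0 := by
  classical
  unfold emap
  rw [Finsupp.lsum_single, LinearMap.smulRight_apply, LinearMap.id_apply, Finsupp.smul_apply,
    smul_eq_mul, Finsupp.finsetSum_apply]
  congr 1
  have key : ∀ s', (Finsupp.mapDomain (fun c => (s', c))
      (contract (MvPolynomial (Fin m) K) n (φ (Finsupp.single t 1) s')
        (Finsupp.single c 1))) (s, c') =
      if s' = s then (if c' ≤ c then coeff (c - c') (φ (Finsupp.single t 1) s) else 0) else 0 := by
    intro s'
    by_cases h : s' = s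
    · subst h
      rw [if_pos rfl, ← contract_single]
      exact Finsupp.mapDomain_apply (f := fun c => (s', c)) (by intro x y hxy; simpa using hxy) _ _
    · rw [if_neg h]
      apply Finsupp.mapDomain_of_notMem_range
      rintro ⟨x, hx⟩
      exact h (by simpa using (Prod.mk.inj hx).1)
  simp only [key]
  rw [Finset.sum_ite_eq']
  split_ifs with h1 h2
  · rfl
  · rfl
  · rw [Finsupp.notMem_support_iff] at h1; rw [h1]; simp
  · rfl

lemma emap_rho (φ : (τ →₀ PP K m n) →ₗ[PP K m n] (σ →₀ PP K m n)) (t : Fin n →₀ ℕ)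
    (f : τ →₀ PP K m n) :
    emap (MvPolynomial (Fin m) K) n φ (rho t f) = rho t (φ f) := by
  classical
  induction f using Finsupp.induction_linear with
  | zero => simp
  | add f g hf hg => simp only [map_add, hf, hg]
  | single s p =>
    induction p using MvPolynomial.induction_on' with
    | add p q hp hq => simp only [Finsupp.single_add, map_add, hp, hq]
    | monomial β a =>
      have h1 : φ (Finsupp.single s (monomial β a)) =
          (monomial β a : PP K m n) • φ (Finsupp.single s 1) := by
        rw [← map_smul, Finsupp.smul_single, smul_eq_mul, mul_one]
      rw [rho_single, h1]
      ext1 ⟨s', c⟩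
      rw [rho_apply, Finsupp.smul_apply, smul_eq_mul, coeff_monomial_mul']
      by_cases hβ : β ≤ t
      · rw [if_pos hβ, emap_single]
        by_cases hc : c ≤ t
        · have : β ≤ t - c ↔ c ≤ t - β := by
            rw [le_tsub_iff_right hc, le_tsub_iff_left hβ]
          rw [if_pos hc]
          simp only [this]
          rw [tsub_right_comm]
          split_ifs <;> simp
        · rw [if_neg hc, if_neg, mul_zero]
          intro h; exact hc (h.trans tsub_le_self)
      · rw [if_neg hβ]
        have : ¬ β ≤ t - c := fun h => hβ (h.trans tsub_le_self)
        simp [this]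

lemma exists_lift (z : EE K m n σ) : ∃ t₀ : Fin n →₀ ℕ, ∀ t, t₀ ≤ t → ∃ f, rho t f = z := by
  induction z using Finsupp.induction_linear with
  | zero => exact ⟨0, fun t _ => ⟨0, map_zero _⟩⟩
  | add f g hf hg =>
    obtain ⟨t1, h1⟩ := hf
    obtain ⟨t2, h2⟩ := hg
    refine ⟨t1 ⊔ t2, fun t ht => ?_⟩
    obtain ⟨f1, hf1⟩ := h1 t (le_sup_left.trans ht)
    obtain ⟨f2, hf2⟩ := h2 t (le_sup_right.trans ht)
    exact ⟨f1 + f2, by rw [map_add, hf1, hf2]⟩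
  | single x a =>
    obtain ⟨s, c⟩ := x
    refine ⟨c, fun t ht => ⟨Finsupp.single s (monomial (t - c) a), ?_⟩⟩
    rw [rho_single, if_pos tsub_le_self, tsub_tsub_cancel_of_le ht]

lemma emap_prE_x (a' : τ → ℤ) (a : σ → ℤ)
    (φ : (τ →₀ PP K m n) →ₗ[PP K m n] (σ →₀ PP K m n)) (h : IsGr (wx m n) a' a φ) (d : ℤ)
    (z : EE K m n τ) : prE (wx m n) a d (emap (MvPolynomial (Fin m) K) n φ z) =
      emap (MvPolynomial (Fin m) K) n φ (prE (wx m n) a' d z) := by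
  obtain ⟨t, ht⟩ := exists_lift z
  obtain ⟨f, rfl⟩ := ht t le_rfl
  rw [emap_rho, rho_prE_x, rho_prE_x, emap_rho, pr_comm _ _ _ _ h]

lemma emap_prE_y (a' : τ → ℤ) (a : σ → ℤ)
    (φ : (τ →₀ PP K m n) →ₗ[PP K m n] (σ →₀ PP K m n)) (h : IsGr (wy m n) a' a φ) (d : ℤ)
    (z : EE K m n τ) : prE (-wy m n) a d (emap (MvPolynomial (Fin m) K) n φ z) =
      emap (MvPolynomial (Fin m) K) n φ (prE (-wy m n) a' d z) := by
  obtain ⟨t, ht⟩ := exists_lift z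
  obtain ⟨f, rfl⟩ := ht t le_rfl
  rw [emap_rho, rho_prE_y, rho_prE_y, emap_rho, pr_comm _ _ _ _ h]

lemma prE_smul_x (a : σ → ℤ) (d δ : ℤ) (g : MvPolynomial (Fin m) K)
    (hg : IsWt (wx m n) δ (C g : PP K m n)) (z : EE K m n σ) :
    prE (wx m n) a d (g • z) = g • prE (wx m n) a (d - δ) z := by
  obtain ⟨t, ht⟩ := exists_lift z
  obtain ⟨f, rfl⟩ := ht t le_rfl
  rw [← rho_smul, rho_prE_x, rho_prE_x, ← rho_smul, pr_smul _ _ _ _ _ hg]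

lemma prE_smul_y (a : σ → ℤ) (d : ℤ) (g : MvPolynomial (Fin m) K) (z : EE K m n σ) :
    prE (-wy m n) a d (g • z) = g • prE (-wy m n) a d z := by
  classical
  obtain ⟨t, ht⟩ := exists_lift z
  obtain ⟨f, rfl⟩ := ht t le_rfl
  rw [← rho_smul, rho_prE_y, rho_prE_y, ← rho_smul, pr_smul _ _ _ 0, sub_zero]
  intro β ν h
  rw [coeff_C] at h
  have : β = 0 := by by_contra h2; simp [Ne.symm h2] at h
  rw [this]; simp [wy_apply, tdeg]

end EProj

section Ker
variable {K : Type} [Field K] {m n : ℕ} {σ τ : Type}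

attribute [local instance] algRP

lemma rho_X_pow_smul (t : Fin n →₀ ℕ) (l : Fin n) (f : σ →₀ PP K m n) :
    rho t (((X l : RR K n) ^ (t l + 1)) • f) = 0 := by
  classical
  ext1 ⟨s, c⟩
  have : ¬ Finsupp.single l (t l + 1) ≤ t - c := by
    intro h
    have := h l
    rw [Finsupp.single_eq_same, Finsupp.tsub_apply] at this
    omega
  rw [rho_apply, Finsupp.smul_apply, X_smul_R, X_pow_eq_monomial, coeff_monomial_mul', if_neg this]
  simp

lemma rho_linear (t : Fin n →₀ ℕ) (ψ : (τ →₀ PP K m n) →ₗ[RR K n] (σ →₀ PP K m n))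
    (f : τ →₀ PP K m n) (hf : rho t f = 0) : rho t (ψ f) = 0 := by
  classical
  have hf' : f = ∑ s ∈ f.support, ∑ β ∈ (f s).support,
      Finsupp.single s (monomial β (coeff β (f s))) := by
    conv_lhs => rw [← Finsupp.sum_single f, Finsupp.sum]
    refine Finset.sum_congr rfl fun s _ => ?_
    conv_lhs => rw [(f s).as_sum, Finsupp.single_finsetSum]
  rw [hf', map_sum, map_sum]
  refine Finset.sum_eq_zero fun s _ => ?_
  rw [map_sum, map_sum]
  refine Finset.sum_eq_zero fun β hβ => ?_
  have hβt : ¬ β ≤ t := by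
    intro h
    have h1 := DFunLike.congr_fun hf (s, t - β)
    rw [rho_apply, if_pos tsub_le_self, tsub_tsub_cancel_of_le h] at h1
    exact (mem_support_iff.1 hβ) h1
  obtain ⟨l, hl⟩ : ∃ l, t l < β l := by
    by_contra h
    push Not at h
    exact hβt h
  have : Finsupp.single s (monomial β (coeff β (f s))) = ((X l : RR K n) ^ (t l + 1)) •
      (Finsupp.single s (monomial (β - Finsupp.single l (t l + 1)) (coeff β (f s))) :
        τ →₀ PP K m n) := by
    rw [Finsupp.smul_single, X_smul_R, X_pow_eq_monomial, monomial_mul, one_mul,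
      add_tsub_cancel_of_le]
    rw [Finsupp.single_le_iff]; omega
  rw [this, map_smul, rho_X_pow_smul]

end Ker
end PaperAux

open MvPolynomial

namespace PaperAux
open Paper

section Abstract
variable {R : Type} [CommRing R] (C : ℕ → Type) [∀ i, AddCommGroup (C i)] [∀ i, Module R (C i)]

lemma exists_homotopy [∀ i, Module.Projective R (C i)] [Subsingleton (C 0)]
    (D : ∀ i, C (i + 1) →ₗ[R] C i)
    (Pi : ∀ i, C i →ₗ[R] C i) (hPi : ∀ i y, Pi i (Pi i y) = Pi i y)
    (hDPi : ∀ i y, D i (Pi (i + 1) y) = Pi i (D i y))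
    (hDD : ∀ i y, D i (D (i + 1) y) = 0)
    (hex : ∀ i y, D i y = 0 → Pi (i + 1) y = y → ∃ c, D (i + 1) c = y) :
    ∃ s : ∀ i, C i →ₗ[R] C (i + 1), ∀ i y, D (i + 1) (s (i + 1) y) + s i (D i y) =
      Pi (i + 1) y := by
  let I : ∀ i, (C i →ₗ[R] C (i + 1)) → Prop := fun i s =>
    (∀ y, Pi (i + 1) (s y) = s y) ∧ ∀ y, D i (s (D i y)) = Pi i (D i y)
  have step : ∀ i (s : C i →ₗ[R] C (i + 1)), I i s → ∃ s' : C (i + 1) →ₗ[R] C (i + 2),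
      I (i + 1) s' ∧ ∀ y, D (i + 1) (s' y) + s (D i y) = Pi (i + 1) y := by
    intro i s hs
    let t : C (i + 1) →ₗ[R] C (i + 1) := Pi (i + 1) - s ∘ₗ D i
    have ht : ∀ y, t y = Pi (i + 1) y - s (D i y) := fun y => rfl
    have ht1 : ∀ y, D i (t y) = 0 := by
      intro y; rw [ht, map_sub, hDPi, hs.2, sub_self]
    have ht2 : ∀ y, Pi (i + 1) (t y) = t y := by
      intro y; rw [ht, map_sub, hPi, hs.1]
    have ht3 : ∀ y, t y ∈ LinearMap.range (D (i + 1)) := fun y => hex i _ (ht1 y) (ht2 y)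
    obtain ⟨h, hh⟩ := Module.projective_lifting_property (D (i + 1)).rangeRestrict
      (t.codRestrict _ ht3) (LinearMap.surjective_rangeRestrict _)
    have hh' : ∀ y, D (i + 1) (h y) = t y := by
      intro y
      have := congrArg Subtype.val (LinearMap.congr_fun hh y)
      exact this
    have key : ∀ y, D (i + 1) ((Pi (i + 2) ∘ₗ h) y) = t y := by
      intro y
      rw [LinearMap.comp_apply, hDPi, hh', ht2]
    refine ⟨Pi (i + 2) ∘ₗ h, ⟨fun y => ?_, fun y => ?_⟩, fun y => ?_⟩
    · rw [LinearMap.comp_apply]; exact hPi _ _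
    · rw [key, ht, hDD, map_zero, sub_zero]
    · rw [key, ht, sub_add_cancel]
  choose! nx hnx using step
  let sq : ∀ i, C i →ₗ[R] C (i + 1) := fun i => Nat.rec (motive := fun i => C i →ₗ[R] C (i + 1))
    0 (fun i s => nx i s) i
  have hsq : ∀ i, I i (sq i) := by
    intro i
    induction i with
    | zero => exact ⟨fun y => by simp [sq], fun y => Subsingleton.elim _ _⟩
    | succ i ih => exact (hnx i _ ih).1
  exact ⟨sq, fun i y => (hnx i _ (hsq i)).2 y⟩

end Abstract

section Cone
set_option maxSynthPendingDepth 10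
variable {K : Type} [Field K] {m n : ℕ}

attribute [local instance] algRP

/-- The weight projection as a `K[y]`-linear map. -/
noncomputable def prR {σ : Type} (a : σ → ℤ) (d : ℤ) :
    (σ →₀ PP K m n) →ₗ[RR K n] (σ →₀ PP K m n) :=
  { pr (wx m n) a d with
    map_smul' := by
      intro r f
      have := pr_smul (wx m n) a d 0 _ (isWt_wx_R (m := m) r) f
      rw [sub_zero, algebraMap_smul, algebraMap_smul] at this
      exact this }

lemma prR_apply {σ : Type} (a : σ → ℤ) (d : ℤ) (f : σ →₀ PP K m n) :
    prR a d f = pr (wx m n) a d f := rfl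

/-- Shifted index types. -/
def sg2 (σ : ℕ → Type) : ℕ → Type
  | 0 => Empty
  | 1 => Empty
  | i + 2 => σ i

/-- Shifted twists. -/
def tw2 {σ : ℕ → Type} (a : ∀ i, σ i → ℤ) : ∀ i, sg2 σ i → ℤ
  | 0 => fun _ => 0
  | 1 => fun _ => 0
  | i + 2 => a i

/-- Shifted complex. -/
noncomputable def ps2 {σ : ℕ → Type}
    (φ : ∀ i, (σ (i + 1) →₀ PP K m n) →ₗ[PP K m n] (σ i →₀ PP K m n)) :
    ∀ i, (sg2 σ (i + 1) →₀ PP K m n) →ₗ[PP K m n] (sg2 σ i →₀ PP K m n)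
  | 0 => 0
  | 1 => 0
  | i + 2 => φ i

variable {σ : ℕ → Type}
    (φ : ∀ i, (σ (i + 1) →₀ PP K m n) →ₗ[PP K m n] (σ i →₀ PP K m n))

/-- The mapping cone. -/
abbrev Cn (K : Type) [Field K] (m n : ℕ) (σ : ℕ → Type) (i : ℕ) : Type :=
  (sg2 σ i →₀ PP K m n) × (sg2 σ (i + 1) →₀ PP K m n)

/-- The cone differential. -/
noncomputable def Dn (g : MvPolynomial (Fin m) K) (i : ℕ) :
    Cn K m n σ (i + 1) →ₗ[RR K n] Cn K m n σ i :=
  LinearMap.restrictScalars (RR K n)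
    (LinearMap.prod ((-(ps2 φ i)) ∘ₗ LinearMap.fst (PP K m n) (sg2 σ (i + 1) →₀ PP K m n)
      (sg2 σ (i + 2) →₀ PP K m n))
    ((C g : PP K m n) • LinearMap.fst (PP K m n) (sg2 σ (i + 1) →₀ PP K m n)
      (sg2 σ (i + 2) →₀ PP K m n) + ps2 φ (i + 1) ∘ₗ LinearMap.snd (PP K m n)
      (sg2 σ (i + 1) →₀ PP K m n) (sg2 σ (i + 2) →₀ PP K m n)))

lemma Dn_apply (g : MvPolynomial (Fin m) K) (i : ℕ) (y : Cn K m n σ (i + 1)) :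
    Dn φ g i y = (-(ps2 φ i y.1), (C g : PP K m n) • y.1 + ps2 φ (i + 1) y.2) := rfl

lemma cone_exact (a : ∀ i, σ i → ℤ)
    (hexact : ∀ i, Function.Exact (φ (i + 1)) (φ i))
    (g : MvPolynomial (Fin m) K) (δ : ℤ) (d : ℤ)
    (M1 : ∀ y, pr (wx m n) (a 0) d y = y → ∃ u v, (C g : PP K m n) • u + φ 0 v = y)
    (M2 : ∀ y, pr (wx m n) (a 0) (d - δ) y = y → (C g : PP K m n) • y ∈ LinearMap.range (φ 0) →
      y ∈ LinearMap.range (φ 0)) (i : ℕ) (u : sg2 σ (i + 1) →₀ PP K m n)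
    (v : sg2 σ (i + 2) →₀ PP K m n) (h1 : ps2 φ i u = 0)
    (h2 : (C g : PP K m n) • u + ps2 φ (i + 1) v = 0)
    (h3 : pr (wx m n) (tw2 a (i + 1)) (d - δ) u = u)
    (h4 : pr (wx m n) (tw2 a (i + 2)) d v = v) :
    ∃ u' v', -(ps2 φ (i + 1) u') = u ∧ (C g : PP K m n) • u' + ps2 φ (i + 2) v' = v := by
  have aux : ∀ i, ∀ (u : σ i →₀ PP K m n) (v : σ (i + 1) →₀ PP K m n),
      (C g : PP K m n) • u + φ i v = 0 → u ∈ LinearMap.range (φ i) →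
      ∃ u' v', -(φ i u') = u ∧ (C g : PP K m n) • u' + φ (i + 1) v' = v := by
    rintro i u v h ⟨u', hu⟩
    have h3 : φ i (v + (C g : PP K m n) • u') = 0 := by
      rw [map_add, map_smul, hu, add_comm]; exact h
    obtain ⟨v', hv⟩ := (hexact i _).1 h3
    refine ⟨-u', v', ?_, ?_⟩
    · rw [map_neg, neg_neg, hu]
    · rw [hv, smul_neg]; abel
  have aux' : ∀ (u : σ 0 →₀ PP K m n) (v : σ 1 →₀ PP K m n),
      (C g : PP K m n) • u + φ 0 v = 0 → (C g : PP K m n) • u ∈ LinearMap.range (φ 0) := by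
    intro u v h
    refine ⟨-v, ?_⟩
    rw [map_neg]; exact (eq_neg_of_add_eq_zero_left h).symm
  cases i with
  | zero =>
    obtain ⟨u', v', h⟩ := M1 v h4
    have h1 : IsEmpty (sg2 σ (0 + 1)) := inferInstanceAs (IsEmpty Empty)
    exact ⟨u', v', Subsingleton.elim _ _, h⟩
  | succ i =>
    cases i with
    | zero =>
      exact aux 0 u v h2 (M2 u h3 (aux' u v h2))
    | succ i => exact aux (i + 1) u v h2 ((hexact i u).1 h1)

lemma cone_homotopy (a : ∀ i, σ i → ℤ)
    (hgr : ∀ i, IsGr (wx m n) (a (i + 1)) (a i) (φ i))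
    (hexact : ∀ i, Function.Exact (φ (i + 1)) (φ i))
    (g : MvPolynomial (Fin m) K) (δ : ℤ) (hg : IsWt (wx m n) δ (C g : PP K m n)) (d : ℤ)
    (M1 : ∀ y, pr (wx m n) (a 0) d y = y → ∃ u v, (C g : PP K m n) • u + φ 0 v = y)
    (M2 : ∀ y, pr (wx m n) (a 0) (d - δ) y = y → (C g : PP K m n) • y ∈ LinearMap.range (φ 0) →
      y ∈ LinearMap.range (φ 0)) :
    ∃ s : ∀ i, Cn K m n σ i →ₗ[RR K n] Cn K m n σ (i + 1), ∀ i y,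
      Dn φ g (i + 1) (s (i + 1) y) + s i (Dn φ g i y) =
        (pr (wx m n) (tw2 a (i + 1)) (d - δ) y.1, pr (wx m n) (tw2 a (i + 2)) d y.2) := by
  have hfree : Module.Free (RR K n) (PP K m n) := free_RP
  have hsub : Subsingleton (Cn K m n σ 0) := by
    have h1 : IsEmpty (sg2 σ 0) := inferInstanceAs (IsEmpty Empty)
    have h2 : IsEmpty (sg2 σ (0 + 1)) := inferInstanceAs (IsEmpty Empty)
    infer_instance
  have hps : ∀ i y, ps2 φ i (ps2 φ (i + 1) y) = 0 := by
    intro i y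
    match i with
    | 0 => rfl
    | 1 => rfl
    | i + 2 => exact (hexact i).apply_apply_eq_zero y
  have hgr2 : ∀ i, IsGr (wx m n) (tw2 a (i + 1)) (tw2 a i) (ps2 φ i) := by
    intro i
    match i with
    | 0 => intro t; exact Empty.elim t
    | 1 => intro t s; exact Empty.elim s
    | i + 2 => exact hgr i
  refine exists_homotopy (R := RR K n) (Cn K m n σ) (Dn φ g)
    (fun i => LinearMap.prodMap (prR (tw2 a i) (d - δ)) (prR (tw2 a (i + 1)) d)) ?_ ?_ ?_ ?_
  · rintro i ⟨u, v⟩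
    simp only [LinearMap.prodMap_apply, prR_apply, pr_idem]
  · rintro i ⟨u, v⟩
    simp only [LinearMap.prodMap_apply, prR_apply, Dn_apply, map_neg, map_add,
      pr_comm _ _ _ _ (hgr2 _), pr_smul _ _ _ _ _ hg]
  · rintro i ⟨u, v⟩
    simp only [Dn_apply, map_neg, map_add, map_smul, hps, Prod.mk_eq_zero]
    simp
  · rintro i ⟨u, v⟩ h1 h2
    simp only [LinearMap.prodMap_apply, prR_apply, Dn_apply, Prod.mk.injEq, Prod.mk_eq_zero,
      neg_eq_zero] at h1 h2
    obtain ⟨u', v', h3, h4⟩ := cone_exact φ a hexact g δ d M1 M2 i u v h1.1 h1.2 h2.1 h2.2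
    refine ⟨(u', v'), ?_⟩
    rw [Dn_apply]
    exact Prod.ext h3 h4

lemma mem_hKer_iff (i : ℕ) (z : EE K m n (σ i)) :
    z ∈ hKer (MvPolynomial (Fin m) K) n σ φ i ↔
      emap (MvPolynomial (Fin m) K) n (σ' := σ i) (ps2 φ (i + 1)) z = 0 := by
  match i with
  | 0 =>
    have h1 : IsEmpty (sg2 σ (0 + 1)) := inferInstanceAs (IsEmpty Empty)
    exact ⟨fun _ => Subsingleton.elim _ _, fun _ => trivial⟩
  | i + 1 => exact Iff.rfl


lemma rho_pair {α β γ ε : Type} (t : Fin n →₀ ℕ)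
    (s : ((α →₀ PP K m n) × (β →₀ PP K m n)) →ₗ[RR K n] ((γ →₀ PP K m n) × (ε →₀ PP K m n)))
    (p : (α →₀ PP K m n) × (β →₀ PP K m n)) (h1 : rho t p.1 = 0) (h2 : rho t p.2 = 0) :
    rho t (s p).1 = 0 ∧ rho t (s p).2 = 0 := by
  have e3 : p = LinearMap.inl (RR K n) _ _ p.1 + LinearMap.inr (RR K n) _ _ p.2 := by
    simp
  have e4 : s p = s (LinearMap.inl (RR K n) _ _ p.1) + s (LinearMap.inr (RR K n) _ _ p.2) := by
    rw [← map_add, ← e3]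
  have a1 := rho_linear t (LinearMap.fst (RR K n) _ _ ∘ₗ s ∘ₗ LinearMap.inl (RR K n) _ _) _ h1
  have a2 := rho_linear t (LinearMap.fst (RR K n) _ _ ∘ₗ s ∘ₗ LinearMap.inr (RR K n) _ _) _ h2
  have a3 := rho_linear t (LinearMap.snd (RR K n) _ _ ∘ₗ s ∘ₗ LinearMap.inl (RR K n) _ _) _ h1
  have a4 := rho_linear t (LinearMap.snd (RR K n) _ _ ∘ₗ s ∘ₗ LinearMap.inr (RR K n) _ _) _ h2
  simp only [LinearMap.comp_apply, LinearMap.fst_apply, LinearMap.snd_apply] at a1 a2 a3 a4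
  rw [e4, Prod.fst_add, Prod.snd_add, map_add, map_add, a1, a2, a3, a4]
  simp

/-- Consequences on `E` of a cone homotopy in `x`-degree `d`. -/
lemma surj_of_homotopy (a : ∀ i, σ i → ℤ) (g : MvPolynomial (Fin m) K) (δ d : ℤ)
    (s : ∀ i, Cn K m n σ i →ₗ[RR K n] Cn K m n σ (i + 1))
    (hs : ∀ i y, Dn φ g (i + 1) (s (i + 1) y) + s i (Dn φ g i y) =
        (pr (wx m n) (tw2 a (i + 1)) (d - δ) y.1, pr (wx m n) (tw2 a (i + 2)) d y.2))
    (i : ℕ) (z : EE K m n (σ i)) (hz : z ∈ hKer (MvPolynomial (Fin m) K) n σ φ i)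
    (hz' : InE (wx m n) (a i) d z) :
    ∃ w ∈ hKer (MvPolynomial (Fin m) K) n σ φ i, ∃ u,
      g • w + emap (MvPolynomial (Fin m) K) n (φ i) u = z := by
  obtain ⟨t, ht⟩ := exists_lift z
  obtain ⟨f, hf⟩ := ht t le_rfl
  let y : Cn K m n σ (i + 1) := (0, f)
  have h := hs i y
  have hD : Dn φ g i y = (0, ps2 φ (i + 1) f) := by
    rw [Dn_apply]; simp [y]
  have hk : rho t (ps2 φ (i + 1) f) = 0 := by
    rw [mem_hKer_iff, ← hf] at hz
    exact (emap_rho (ps2 φ (i + 1)) t f).symm.trans hz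
  obtain ⟨h1, h2⟩ := rho_pair t (s i) (Dn φ g i y) (by rw [hD, map_zero]) (by rw [hD]; exact hk)
  rw [Dn_apply, Prod.ext_iff] at h
  obtain ⟨ha, hb⟩ := h
  simp only [Prod.fst_add, Prod.snd_add] at ha hb
  set q := s (i + 1) y
  refine ⟨rho t (σ := σ i) q.1, ?_, rho t (σ := σ (i + 1)) q.2, ?_⟩
  · rw [mem_hKer_iff]
    refine (emap_rho (ps2 φ (i + 1)) t q.1).trans ?_
    have := congrArg (rho t) ha
    rw [map_add, h1, add_zero, map_neg, map_zero, map_zero, neg_eq_zero] at this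
    exact this
  · have := congrArg (rho t) hb
    rw [map_add, h2, add_zero, map_add, rho_smul, ← emap_rho] at this
    refine this.trans ?_
    change rho t (pr (wx m n) (a i) d f) = z
    rw [← rho_prE_x, hf, prE_of_inE _ _ _ _ hz']

lemma inj_of_homotopy (a : ∀ i, σ i → ℤ) (g : MvPolynomial (Fin m) K) (δ d : ℤ)
    (s : ∀ i, Cn K m n σ i →ₗ[RR K n] Cn K m n σ (i + 1))
    (hs : ∀ i y, Dn φ g (i + 1) (s (i + 1) y) + s i (Dn φ g i y) =
        (pr (wx m n) (tw2 a (i + 1)) (d - δ) y.1, pr (wx m n) (tw2 a (i + 2)) d y.2))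
    (i : ℕ) (w : EE K m n (σ i)) (hw : w ∈ hKer (MvPolynomial (Fin m) K) n σ φ i)
    (hw' : InE (wx m n) (a i) (d - δ) w)
    (hg : g • w ∈ LinearMap.range (emap (MvPolynomial (Fin m) K) n (φ i))) :
    w ∈ LinearMap.range (emap (MvPolynomial (Fin m) K) n (φ i)) := by
  obtain ⟨u, hu⟩ := hg
  obtain ⟨t1, ht1⟩ := exists_lift w
  obtain ⟨t2, ht2⟩ := exists_lift u
  obtain ⟨f, hf⟩ := ht1 (t1 ⊔ t2) le_sup_left
  obtain ⟨v, hv⟩ := ht2 (t1 ⊔ t2) le_sup_right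
  generalize t1 ⊔ t2 = t at hf hv
  let y : Cn K m n σ (i + 2) := (f, -v)
  have h := hs (i + 1) y
  have hk1 : rho t (Dn φ g (i + 1) y).1 = 0 := by
    rw [mem_hKer_iff, ← hf] at hw
    rw [Dn_apply, map_neg, neg_eq_zero]
    exact (emap_rho (ps2 φ (i + 1)) t f).symm.trans hw
  have hk2 : rho t (Dn φ g (i + 1) y).2 = 0 := by
    have : rho t ((C g : PP K m n) • f + φ i (-v)) = 0 := by
      rw [map_neg, ← sub_eq_add_neg, map_sub, rho_smul, ← emap_rho, hv, hf, hu, sub_self]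
    exact this
  obtain ⟨h1, h2⟩ := rho_pair t (s (i + 1)) (Dn φ g (i + 1) y) hk1 hk2
  rw [Dn_apply, Prod.ext_iff] at h
  have ha := h.1
  simp only [Prod.fst_add] at ha
  set q := s (i + 2) y
  refine ⟨-(rho t (σ := σ (i + 1)) q.1), ?_⟩
  have := congrArg (rho t) ha
  rw [map_add, h1, add_zero, map_neg, ← emap_rho] at this
  rw [map_neg]
  refine this.trans ?_
  change rho t (pr (wx m n) (a i) (d - δ) f) = w
  rw [← rho_prE_x, hf, prE_of_inE _ _ _ _ hw']

end Cone
end PaperAux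

open MvPolynomial

namespace PaperAux
open Paper

lemma pow_le_aux {S : Type} [CommRing S] {F : Type} [AddCommGroup F] [Module S F]
    (I J : Ideal S) (Q : Submodule S F)
    (h : I • (⊤ : Submodule S F) ≤ J • ⊤ ⊔ Q) (k : ℕ) :
    I ^ k • (⊤ : Submodule S F) ≤ J ^ k • ⊤ ⊔ Q := by
  induction k with
  | zero => simp
  | succ k ih =>
    calc I ^ (k + 1) • (⊤ : Submodule S F) = I • (I ^ k • ⊤) := by
          rw [pow_succ', Submodule.mul_smul]
      _ ≤ I • (J ^ k • ⊤ ⊔ Q) := Submodule.smul_mono le_rfl ih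
      _ = J ^ k • (I • ⊤) ⊔ I • Q := by
          rw [Submodule.smul_sup, ← Submodule.mul_smul, mul_comm, Submodule.mul_smul]
      _ ≤ J ^ k • (J • ⊤ ⊔ Q) ⊔ Q := sup_le_sup (Submodule.smul_mono le_rfl h)
          Submodule.smul_le_right
      _ ≤ J ^ (k + 1) • ⊤ ⊔ Q := by
          rw [Submodule.smul_sup, ← Submodule.mul_smul, ← pow_succ]
          refine sup_le (sup_le le_sup_left ?_) le_sup_right
          exact Submodule.smul_le_right.trans le_sup_right

lemma sup_pow_le_aux {S : Type} [CommRing S] (I J : Ideal S) (k : ℕ) :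
    (I ⊔ J) ^ k ≤ I ^ k ⊔ J := by
  induction k with
  | zero => simp
  | succ k ih =>
    rw [pow_succ]
    refine (Ideal.mul_mono_left ih).trans ?_
    rw [Ideal.mul_sup, Ideal.sup_mul, ← pow_succ]
    refine sup_le (sup_le le_sup_left ?_) ?_
    · exact le_trans (Ideal.mul_le_left : J * I ≤ J) le_sup_right
    · exact le_trans (Ideal.mul_le_right : (I ^ k ⊔ J) * J ≤ J) le_sup_right

section MFacts
set_option maxSynthPendingDepth 10
variable {K : Type} [Field K] {m n : ℕ} {σ : Type}

lemma smul_apply_mem (I : Ideal (PP K m n)) (f : σ →₀ PP K m n)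
    (hf : f ∈ I • (⊤ : Submodule (PP K m n) (σ →₀ PP K m n))) (s : σ) : f s ∈ I := by
  induction hf using Submodule.smul_induction_on' with
  | smul r hr x hx => rw [Finsupp.smul_apply, smul_eq_mul]; exact I.mul_mem_right _ hr
  | add x hx y hy h1 h2 => rw [Finsupp.add_apply]; exact add_mem h1 h2

lemma isWt_C_wy (u : MvPolynomial (Fin m) K) : IsWt (wy m n) 0 (C u : PP K m n) := by
  classical
  intro β ν h
  rw [coeff_C] at h
  have : β = 0 := by by_contra h2; simp [Ne.symm h2] at h
  rw [this]; simp [wy_apply, tdeg]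

lemma pr_wy_pow (b : σ → ℤ) (d : ℤ) (k : ℕ) (hk : ∀ s, d - b s < k) (f : σ →₀ PP K m n)
    (hf : f ∈ (idealOfVars (Fin n) (MvPolynomial (Fin m) K)) ^ k •
      (⊤ : Submodule (PP K m n) (σ →₀ PP K m n))) : pr (wy m n) b d f = 0 := by
  ext s β ν
  rw [pr_apply, coeff_prP]
  split_ifs with h
  · have h1 := smul_apply_mem _ f hf s
    rw [mem_pow_idealOfVars_iff'] at h1
    have h2 := hk s
    rw [wy_apply, tdeg_eq] at h
    rw [h1 β (by omega)]; simp
  · simp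

lemma exists_pow_mem [Finite σ] (b : σ → ℤ) (Q : Submodule (PP K m n) (σ →₀ PP K m n))
    (hQ : ∀ d, ∀ q ∈ Q, pr (wy m n) b d q ∈ Q) (J : Ideal (MvPolynomial (Fin m) K))
    (hJ : ∀ u ∈ J, ∀ f, (C u : PP K m n) • f ∈ idealOfVars (Fin n) (MvPolynomial (Fin m) K) •
      (⊤ : Submodule (PP K m n) (σ →₀ PP K m n)) ⊔ Q) :
    ∃ k : ℕ, ∀ u ∈ J ^ k, ∀ f, (C u : PP K m n) • f ∈ Q := by
  obtain ⟨k, hk⟩ : ∃ k : ℕ, ∀ s s', b s - b s' < k := by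
    obtain ⟨B, hB⟩ := (Set.finite_range fun p : σ × σ => b p.1 - b p.2).bddAbove
    refine ⟨B.toNat + 1, fun s s' => ?_⟩
    have := hB ⟨(s, s'), rfl⟩
    simp only at this
    push_cast
    have := Int.self_le_toNat B
    omega
  refine ⟨k, fun u hu f => ?_⟩
  have hle : (Ideal.map C J : Ideal (PP K m n)) • (⊤ : Submodule (PP K m n) (σ →₀ PP K m n)) ≤
      idealOfVars (Fin n) (MvPolynomial (Fin m) K) • ⊤ ⊔ Q := by
    rw [Ideal.map, Submodule.span_smul_eq, Submodule.set_smul_le_iff]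
    rintro _ f ⟨u, hu, rfl⟩ _
    exact hJ u hu f
  have h2 := pow_le_aux _ _ Q hle k
  rw [← Ideal.map_pow] at h2
  have key : ∀ s, (C u : PP K m n) • (Finsupp.single s 1 : σ →₀ PP K m n) ∈ Q := by
    intro s
    have h3 := h2 (Submodule.smul_mem_smul (Ideal.mem_map_of_mem C hu)
      (Submodule.mem_top (x := (Finsupp.single s 1 : σ →₀ PP K m n))))
    obtain ⟨p, hp, q, hq, hpq⟩ := Submodule.mem_sup.1 h3
    have h4 := congrArg (pr (wy m n) b (b s)) hpq
    rw [map_add, pr_wy_pow b (b s) k (hk s) p hp, zero_add, pr_smul _ _ _ _ _ (isWt_C_wy u),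
      sub_zero, pr_single, sub_self, prP_of_isWt] at h4
    · rw [← h4]; exact hQ _ _ hq
    · exact isWt_C_wy 1
  induction f using Finsupp.induction_linear with
  | zero => simp
  | add f g hf hg => rw [smul_add]; exact add_mem hf hg
  | single s p =>
    have : (C u : PP K m n) • Finsupp.single s p =
        p • ((C u : PP K m n) • (Finsupp.single s 1 : σ →₀ PP K m n)) := by
      rw [smul_comm, Finsupp.smul_single p, smul_eq_mul, mul_one]
    rw [this]; exact Q.smul_mem _ (key s)

lemma homog_mem (a : σ → ℤ) (T : Submodule (PP K m n) (σ →₀ PP K m n)) (N : ℕ)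
    (hT : ∀ u ∈ (idealOfVars (Fin m) K) ^ N, ∀ f, (C u : PP K m n) • f ∈ T) (d : ℤ)
    (hd : ∀ s, N + a s ≤ d) (y : σ →₀ PP K m n) (hy : pr (wx m n) a d y = y) : y ∈ T := by
  classical
  have hf' : y = ∑ s ∈ y.support, ∑ β ∈ (y s).support,
      Finsupp.single s (monomial β (coeff β (y s))) := by
    conv_lhs => rw [← Finsupp.sum_single y, Finsupp.sum]
    refine Finset.sum_congr rfl fun s _ => ?_
    conv_lhs => rw [(y s).as_sum, Finsupp.single_finsetSum]
  rw [hf']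
  refine Submodule.sum_mem _ fun s _ => Submodule.sum_mem _ fun β _ => ?_
  have h1 : coeff β (y s) ∈ (idealOfVars (Fin m) K) ^ N := by
    rw [mem_pow_idealOfVars_iff']
    intro ν hν
    rw [← hy, pr_apply, coeff_prP, if_neg]
    rw [wx_apply, tdeg_eq]
    have := hd s
    omega
  have h2 := hT _ h1 (Finsupp.single s (monomial β 1))
  rwa [Finsupp.smul_single, smul_eq_mul, C_mul_monomial, mul_one] at h2

lemma pr_pr_ne (w : Wt m n) (a : σ → ℤ) (d e : ℤ) (h : d ≠ e) (f : σ →₀ PP K m n) :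
    pr w a e (pr w a d f) = 0 := by
  ext1 s
  rw [pr_apply, pr_apply, prP_of_isWt_ne _ _ _ _ (isWt_prP _ _ _)]
  · simp
  · omega

lemma exists_pr_zero [Finite σ] (w : Wt m n) (a : σ → ℤ) (f : σ →₀ PP K m n) :
    ∃ B : ℤ, ∀ d, B ≤ d → pr w a d f = 0 := by
  obtain ⟨T, hT⟩ := exists_pr_sum w a f
  obtain ⟨B, hB⟩ := T.bddAbove
  refine ⟨B + 1, fun d hd => ?_⟩
  rw [← hT, map_sum]
  refine Finset.sum_eq_zero fun e he => pr_pr_ne _ _ _ _ ?_ _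
  have := hB he
  omega

lemma M2_aux [Finite σ] (a : σ → ℤ) (L Q : Submodule (PP K m n) (σ →₀ PP K m n))
    (hQ : ∀ d, ∀ q ∈ Q, pr (wx m n) a d q ∈ Q) (N : ℕ)
    (hL : ∀ u ∈ (idealOfVars (Fin m) K) ^ N, ∀ f ∈ L, (C u : PP K m n) • f ∈ Q) :
    ∃ B : ℤ, ∀ d, B ≤ d → ∀ f ∈ L, pr (wx m n) a d f ∈ Q := by
  classical
  have h1 : ∀ l ∈ L, ∃ B : ℤ, ∀ d, B ≤ d → ∀ p : PP K m n, pr (wx m n) a d (p • l) ∈ Q := by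
    intro l hl
    obtain ⟨B, hB⟩ := exists_pr_zero (wx m n) a l
    refine ⟨B + N, fun d hd p => ?_⟩
    induction p using MvPolynomial.induction_on' with
    | add p q hp hq => rw [add_smul, map_add]; exact add_mem hp hq
    | monomial β c =>
      induction c using MvPolynomial.induction_on' with
      | add p q hp hq => rw [map_add (monomial β), add_smul, map_add]; exact add_mem hp hq
      | monomial ν r =>
        by_cases hν : N ≤ ν.degree
        · apply hQ
          have e : (monomial β (monomial ν r) : PP K m n) =
              C (monomial ν r) * monomial β 1 := by rw [C_mul_monomial, mul_one]
          rw [e, mul_smul]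
          refine hL _ ?_ _ (L.smul_mem _ hl)
          rw [mem_pow_idealOfVars_iff']
          intro x hx
          rw [coeff_monomial, if_neg]
          rintro rfl; omega
        · have hw : IsWt (wx m n) (ν.degree) (monomial β (monomial ν r) : PP K m n) := by
            intro β' ν' h
            rw [coeff_monomial] at h
            split_ifs at h with h2
            · rw [coeff_monomial] at h
              split_ifs at h with h3
              · rw [h3]; rfl
              · exact absurd rfl h
            · simp at h
          rw [pr_smul _ _ _ _ _ hw, hB _ (by omega), smul_zero]
          exact zero_mem _
  choose! Bf hBf using h1
  have hfg : L.FG := IsNoetherian.noetherian L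
  obtain ⟨S, hS⟩ := hfg
  obtain ⟨B, hB⟩ := (S.image Bf).bddAbove
  refine ⟨B, fun d hd f hf => ?_⟩
  let U : Submodule (PP K m n) (σ →₀ PP K m n) :=
    { carrier := {f | ∀ p : PP K m n, pr (wx m n) a d (p • f) ∈ Q}
      add_mem' := by
        intro x y hx hy p
        rw [smul_add, map_add]; exact add_mem (hx p) (hy p)
      zero_mem' := by intro p; simp
      smul_mem' := by
        intro c x hx p
        rw [← mul_smul]; exact hx _ }
  have hLU : L ≤ U := by
    rw [← hS, Submodule.span_le]
    intro l hl p
    refine hBf l (hS ▸ Submodule.subset_span hl) d ?_ p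
    exact (hB (Finset.mem_image_of_mem _ hl)).trans hd
  have := hLU hf 1
  rwa [one_smul] at this

lemma M_facts [Finite σ] (a b : σ → ℤ) (Q : Submodule (PP K m n) (σ →₀ PP K m n))
    (hQx : ∀ d, ∀ q ∈ Q, pr (wx m n) a d q ∈ Q)
    (hQy : ∀ d, ∀ q ∈ Q, pr (wy m n) b d q ∈ Q) (J : Ideal (MvPolynomial (Fin m) K))
    (hJ : ∀ u ∈ J, ∀ f, (C u : PP K m n) • f ∈ idealOfVars (Fin n) (MvPolynomial (Fin m) K) •
      (⊤ : Submodule (PP K m n) (σ →₀ PP K m n)) ⊔ Q)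
    (g : MvPolynomial (Fin m) K) (N : ℕ)
    (hN : (idealOfVars (Fin m) K) ^ N ≤ J ⊔ Ideal.span {g}) :
    ∃ B : ℤ, ∀ d, B ≤ d → 
      (∀ y, pr (wx m n) a d y = y → ∃ u, ∃ v ∈ Q, (C g : PP K m n) • u + v = y) ∧
      (∀ y, pr (wx m n) a d y = y → (C g : PP K m n) • y ∈ Q → y ∈ Q) := by
  obtain ⟨k, hk⟩ := exists_pow_mem b Q hQy J hJ
  have hN' : (idealOfVars (Fin m) K) ^ (N * k) ≤ J ^ k ⊔ Ideal.span {g} := by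
    rw [pow_mul]
    exact (Ideal.pow_right_mono hN k).trans (sup_pow_le_aux _ _ _)
  have hsplit : ∀ u ∈ (idealOfVars (Fin m) K) ^ (N * k), ∃ v ∈ J ^ k, ∃ h, u = v + h * g := by
    intro u hu
    obtain ⟨v, hv, w, hw, rfl⟩ := Submodule.mem_sup.1 (hN' hu)
    obtain ⟨h, rfl⟩ := Ideal.mem_span_singleton'.1 hw
    exact ⟨v, hv, h, rfl⟩
  let T : Submodule (PP K m n) (σ →₀ PP K m n) :=
    LinearMap.range (LinearMap.lsmul (PP K m n) (σ →₀ PP K m n) (C g)) ⊔ Q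
  let L : Submodule (PP K m n) (σ →₀ PP K m n) :=
    Q.comap (LinearMap.lsmul (PP K m n) (σ →₀ PP K m n) (C g))
  have hT : ∀ u ∈ (idealOfVars (Fin m) K) ^ (N * k), ∀ f, (C u : PP K m n) • f ∈ T := by
    intro u hu f
    obtain ⟨v, hv, h, rfl⟩ := hsplit u hu
    rw [C_add, C_mul, add_smul, mul_comm, mul_smul, add_comm]
    exact Submodule.add_mem_sup ⟨_, rfl⟩ (hk v hv f)
  have hL : ∀ u ∈ (idealOfVars (Fin m) K) ^ (N * k), ∀ f ∈ L, (C u : PP K m n) • f ∈ Q := by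
    intro u hu f hf
    obtain ⟨v, hv, h, rfl⟩ := hsplit u hu
    rw [C_add, C_mul, add_smul, mul_smul]
    exact add_mem (hk v hv f) (Q.smul_mem _ hf)
  obtain ⟨B, hB⟩ := M2_aux a L Q hQx _ hL
  obtain ⟨A, hA⟩ := (Set.finite_range a).bddAbove
  refine ⟨max B ((N * k : ℕ) + A), fun d hd => ⟨fun y hy => ?_, fun y hy hgy => ?_⟩⟩
  · have := homog_mem a T _ hT d (fun s => ?_) y hy
    · obtain ⟨_, ⟨u, rfl⟩, v, hv, h⟩ := Submodule.mem_sup.1 this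
      exact ⟨u, v, hv, h⟩
    · have h1 := hA ⟨s, rfl⟩
      have h2 := (le_max_right _ _).trans hd
      omega
  · have := hB d ((le_max_left _ _).trans hd) y hgy
    rwa [hy] at this

end MFacts
end PaperAux

open MvPolynomial

namespace PaperAux
open Paper

section ModSide
set_option maxSynthPendingDepth 10
variable {K : Type} [Field K] {m n : ℕ} {σ : Type}

lemma isWt_X_wx (l : Fin n) : IsWt (wx m n) 0 (X l : PP K m n) := by
  classical
  intro β ν h
  rw [coeff_X] at h
  have : ν = 0 := by
    by_contra h2
    split_ifs at h
    · rw [coeff_one, if_neg (Ne.symm h2)] at h; exact h rfl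
    · exact h (coeff_zero _)
  rw [this]; simp [wx_apply, tdeg]

lemma pr_smul_top (a : σ → ℤ) (d : ℤ) (f : σ →₀ PP K m n)
    (hf : f ∈ idealOfVars (Fin n) (MvPolynomial (Fin m) K) •
      (⊤ : Submodule (PP K m n) (σ →₀ PP K m n))) :
    pr (wx m n) a d f ∈ idealOfVars (Fin n) (MvPolynomial (Fin m) K) •
      (⊤ : Submodule (PP K m n) (σ →₀ PP K m n)) := by
  induction hf using Submodule.smul_induction_on' with
  | smul r hr x hx =>
    clear hx
    rw [idealOfVars] at hr
    induction hr using Submodule.span_induction generalizing x with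
    | mem r hr =>
      obtain ⟨l, rfl⟩ := hr
      rw [pr_smul _ _ _ 0 _ (isWt_X_wx l)]
      exact Submodule.smul_mem_smul (Ideal.subset_span ⟨l, rfl⟩) trivial
    | zero => rw [zero_smul, map_zero]; exact zero_mem _
    | add r r' _ _ h1 h2 => rw [add_smul, map_add]; exact add_mem (h1 x) (h2 x)
    | smul p r _ h => 
      rw [smul_eq_mul, mul_comm, mul_smul]; exact h _
  | add x hx y hy h1 h2 => rw [map_add]; exact add_mem h1 h2

lemma pr_C_single (a : σ → ℤ) (s : σ) (e : ℕ) (u : MvPolynomial (Fin m) K) :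
    pr (wx m n) a (e + a s) ((C u : PP K m n) • Finsupp.single s (1 : PP K m n)) =
      (C (homogeneousComponent e u) : PP K m n) • Finsupp.single s (1 : PP K m n) := by
  classical
  rw [Finsupp.smul_single, Finsupp.smul_single, pr_single]
  congr 1
  ext β ν
  rw [coeff_prP, smul_eq_mul, mul_one, smul_eq_mul, mul_one, coeff_C, coeff_C, wx_apply, tdeg_eq]
  have : ((ν.degree : ℤ) = e + a s - a s) ↔ ν.degree = e := by
    rw [add_sub_cancel_right]; exact Nat.cast_inj
  simp only [this]
  by_cases h : 0 = β
  · simp only [if_pos h, coeff_homogeneousComponent]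
  · simp only [if_neg h, coeff_zero, ite_self]

variable {M : Type} [AddCommGroup M] [Module (MvPolynomial (Fin m) K) M] [Module (PP K m n) M]
  [IsScalarTower (MvPolynomial (Fin m) K) (PP K m n) M]

lemma mem_ann_iff (ε : (σ →₀ PP K m n) →ₗ[PP K m n] M) (hsurj : Function.Surjective ε)
    (u : MvPolynomial (Fin m) K) :
    u ∈ Module.annihilator (MvPolynomial (Fin m) K)
          (M ⧸ Submodule.restrictScalars (MvPolynomial (Fin m) K)
            ((Ideal.span (Set.range (X : Fin n → PP K m n))) • (⊤ : Submodule (PP K m n) M))) ↔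
    ∀ f, (C u : PP K m n) • f ∈ idealOfVars (Fin n) (MvPolynomial (Fin m) K) •
      (⊤ : Submodule (PP K m n) (σ →₀ PP K m n)) ⊔ LinearMap.ker ε := by
  have h0 : (idealOfVars (Fin n) (MvPolynomial (Fin m) K) •
      (⊤ : Submodule (PP K m n) (σ →₀ PP K m n)) ⊔ LinearMap.ker ε) =
      Submodule.comap ε ((Ideal.span (Set.range (X : Fin n → PP K m n))) •
        (⊤ : Submodule (PP K m n) M)) := by
    rw [← Submodule.comap_map_eq, Submodule.map_smul'', Submodule.map_top,
      LinearMap.range_eq_top.2 hsurj]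
  rw [h0, Module.mem_annihilator]
  constructor
  · intro h f
    have h1 := h (Submodule.Quotient.mk (ε f))
    rw [← Submodule.Quotient.mk_smul, Submodule.Quotient.mk_eq_zero] at h1
    rw [Submodule.mem_comap, map_smul]
    have h2 : (C u : PP K m n) • ε f = u • ε f := algebraMap_smul (PP K m n) u (ε f)
    rw [h2]; exact h1
  · intro h x
    obtain ⟨x, rfl⟩ := Submodule.Quotient.mk_surjective _ x
    obtain ⟨f, rfl⟩ := hsurj x
    rw [← Submodule.Quotient.mk_smul, Submodule.Quotient.mk_eq_zero]
    have h1 := h f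
    rw [Submodule.mem_comap, map_smul] at h1
    have h2 : (C u : PP K m n) • ε f = u • ε f := algebraMap_smul (PP K m n) u (ε f)
    rw [h2] at h1; exact h1

lemma ann_homog (ε : (σ →₀ PP K m n) →ₗ[PP K m n] M) (hsurj : Function.Surjective ε)
    (a : σ → ℤ) (hQx : ∀ d, ∀ q ∈ LinearMap.ker ε, pr (wx m n) a d q ∈ LinearMap.ker ε)
    (u : MvPolynomial (Fin m) K)
    (hu : u ∈ Module.annihilator (MvPolynomial (Fin m) K)
          (M ⧸ Submodule.restrictScalars (MvPolynomial (Fin m) K)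
            ((Ideal.span (Set.range (X : Fin n → PP K m n))) • (⊤ : Submodule (PP K m n) M))))
    (e : ℕ) : homogeneousComponent e u ∈ Module.annihilator (MvPolynomial (Fin m) K)
          (M ⧸ Submodule.restrictScalars (MvPolynomial (Fin m) K)
            ((Ideal.span (Set.range (X : Fin n → PP K m n))) • (⊤ : Submodule (PP K m n) M))) := by
  rw [mem_ann_iff ε hsurj] at hu ⊢
  intro f
  induction f using Finsupp.induction_linear with
  | zero => rw [smul_zero]; exact zero_mem _
  | add f g hf hg => rw [smul_add]; exact add_mem hf hg
  | single s p =>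
    have h1 : (Finsupp.single s p : σ →₀ PP K m n) = p • Finsupp.single s 1 := by
      rw [Finsupp.smul_single, smul_eq_mul, mul_one]
    rw [h1, smul_comm]
    apply Submodule.smul_mem
    rw [← pr_C_single a s e u]
    obtain ⟨x, hx, y, hy, hxy⟩ := Submodule.mem_sup.1 (hu (Finsupp.single s 1))
    rw [← hxy, map_add]
    exact Submodule.add_mem_sup (pr_smul_top a _ x hx) (hQx _ y hy)

lemma isWt_C_homog (g : MvPolynomial (Fin m) K) (δ : ℕ) (hg : g.IsHomogeneous δ) :
    IsWt (wx m n) δ (C g : PP K m n) := by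
  classical
  intro β ν h
  rw [coeff_C] at h
  split_ifs at h
  · rw [wx_apply, tdeg_eq]
    have := hg h
    have h3 : ν.degree = δ := by
      rw [Finsupp.degree_eq_weight_one]; exact this
    exact_mod_cast h3
  · exact absurd (coeff_zero _) h

lemma homog_mem_vars (g : MvPolynomial (Fin m) K) (δ : ℕ) (hδ : 1 ≤ δ) (hg : g.IsHomogeneous δ) :
    g ∈ idealOfVars (Fin m) K := by
  rw [← pow_one (idealOfVars (Fin m) K), mem_pow_idealOfVars_iff']
  intro x hx
  by_contra h
  have := hg h
  have h3 : x.degree = δ := by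
    rw [Finsupp.degree_eq_weight_one]; exact this
  omega

end ModSide
end PaperAux

open MvPolynomial

namespace PaperAux
open Paper

section CohSide
set_option maxSynthPendingDepth 10
variable {K : Type} [Field K] {m n : ℕ} {σ : ℕ → Type}
  (φ : ∀ i, ((σ (i + 1)) →₀ PP K m n) →ₗ[PP K m n] ((σ i) →₀ PP K m n))
  (D : ∀ i, σ i → ℤ × ℤ)

/-- the boundaries -/
noncomputable abbrev Bd (i : ℕ) : Submodule (MvPolynomial (Fin m) K) (EE K m n (σ i)) :=
  LinearMap.range (emap (MvPolynomial (Fin m) K) n (φ i))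

/-- the cohomology -/
noncomputable abbrev HH (i : ℕ) (j : ℤ) :
    Submodule (MvPolynomial (Fin m) K) (EE K m n (σ i) ⧸ Bd φ i) :=
  Hy (MvPolynomial (Fin m) K) n σ φ (fun i s => (D i s).2) i j

lemma mem_HH (i : ℕ) (j : ℤ) (v : EE K m n (σ i) ⧸ Bd φ i) :
    v ∈ HH φ D i j ↔ ∃ z, z ∈ hKer (MvPolynomial (Fin m) K) n σ φ i ∧
      InE (-wy m n) (fun s => (D i s).2) (j + n) z ∧ (Bd φ i).mkQ z = v := by
  unfold HH Hy
  rw [Submodule.mem_map]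
  constructor
  · rintro ⟨z, ⟨h1, h2⟩, h3⟩
    exact ⟨z, h1, (mem_ystrand_iff _ _ _).1 h2, h3⟩
  · rintro ⟨z, h1, h2, h3⟩
    exact ⟨z, ⟨h1, (mem_ystrand_iff _ _ _).2 h2⟩, h3⟩

lemma mem_HyGr (i : ℕ) (j e : ℤ) (v : HH φ D i j) :
    v ∈ HyGr K m n σ φ D i j e ↔ ∃ z, z ∈ hKer (MvPolynomial (Fin m) K) n σ φ i ∧
      InE (-wy m n) (fun s => (D i s).2) (j + n) z ∧ InE (wx m n) (fun s => (D i s).1) e z ∧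
      (Bd φ i).mkQ z = v.1 := by
  unfold HyGr
  rw [Submodule.mem_comap, Submodule.mem_map]
  constructor
  · rintro ⟨z, ⟨⟨h1, h2⟩, h4⟩, h3⟩
    exact ⟨z, h1, (mem_ystrand_iff _ _ _).1 h2, (mem_xstrandE_iff _ _ _).1 h4, h3⟩
  · rintro ⟨z, h1, h2, h4, h3⟩
    exact ⟨z, ⟨⟨h1, (mem_ystrand_iff _ _ _).2 h2⟩, (mem_xstrandE_iff _ _ _).2 h4⟩, h3⟩

variable {D}

lemma hKer_prE_x (hx : ∀ i, IsGr (wx m n) (fun s => (D (i + 1) s).1) (fun s => (D i s).1) (φ i))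
    (i : ℕ) (d : ℤ) (z : EE K m n (σ i)) (hz : z ∈ hKer (MvPolynomial (Fin m) K) n σ φ i) :
    prE (wx m n) (fun s => (D i s).1) d z ∈ hKer (MvPolynomial (Fin m) K) n σ φ i := by
  match i with
  | 0 => trivial
  | i + 1 =>
    change emap (MvPolynomial (Fin m) K) n (φ i) _ = 0
    rw [← emap_prE_x _ _ _ (hx i)]
    have h : emap (MvPolynomial (Fin m) K) n (φ i) z = 0 := hz
    rw [h, map_zero]

lemma hKer_prE_y (hy : ∀ i, IsGr (wy m n) (fun s => (D (i + 1) s).2) (fun s => (D i s).2) (φ i))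
    (i : ℕ) (d : ℤ) (z : EE K m n (σ i)) (hz : z ∈ hKer (MvPolynomial (Fin m) K) n σ φ i) :
    prE (-wy m n) (fun s => (D i s).2) d z ∈ hKer (MvPolynomial (Fin m) K) n σ φ i := by
  match i with
  | 0 => trivial
  | i + 1 =>
    change emap (MvPolynomial (Fin m) K) n (φ i) _ = 0
    rw [← emap_prE_y _ _ _ (hy i)]
    have h : emap (MvPolynomial (Fin m) K) n (φ i) z = 0 := hz
    rw [h, map_zero]

lemma Bd_prE_x (hx : ∀ i, IsGr (wx m n) (fun s => (D (i + 1) s).1) (fun s => (D i s).1) (φ i))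
    (i : ℕ) (d : ℤ) (z : EE K m n (σ i)) (hz : z ∈ Bd φ i) :
    prE (wx m n) (fun s => (D i s).1) d z ∈ Bd φ i := by
  obtain ⟨u, rfl⟩ := hz
  rw [emap_prE_x _ _ _ (hx i)]
  exact ⟨_, rfl⟩

/-- the projection on cohomology -/
noncomputable def qpr
    (hx : ∀ i, IsGr (wx m n) (fun s => (D (i + 1) s).1) (fun s => (D i s).1) (φ i))
    (i : ℕ) (d : ℤ) : (EE K m n (σ i) ⧸ Bd φ i) →+ (EE K m n (σ i) ⧸ Bd φ i) :=
  QuotientAddGroup.map (Bd φ i).toAddSubgroup (Bd φ i).toAddSubgroup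
    (prE (wx m n) (fun s => (D i s).1) d) (fun z hz => Bd_prE_x φ hx i d z hz)

lemma qpr_mk (hx : ∀ i, IsGr (wx m n) (fun s => (D (i + 1) s).1) (fun s => (D i s).1) (φ i))
    (i : ℕ) (d : ℤ) (z : EE K m n (σ i)) :
    qpr φ hx i d ((Bd φ i).mkQ z) = (Bd φ i).mkQ (prE (wx m n) (fun s => (D i s).1) d z) := rfl

lemma qpr_mem (hx : ∀ i, IsGr (wx m n) (fun s => (D (i + 1) s).1) (fun s => (D i s).1) (φ i))
    (i : ℕ) (d j : ℤ) (v) (hv : v ∈ HH φ D i j) : qpr φ hx i d v ∈ HH φ D i j := by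
  rw [mem_HH] at hv ⊢
  obtain ⟨z, h1, h2, rfl⟩ := hv
  exact ⟨_, hKer_prE_x φ hx i d z h1, inE_prE_of_inE _ _ _ _ _ _ _ h2, (qpr_mk φ hx i d z).symm⟩

/-- the projection on the graded component -/
noncomputable def hpr (hx : ∀ i, IsGr (wx m n) (fun s => (D (i + 1) s).1) (fun s => (D i s).1) (φ i))
    (i : ℕ) (j d : ℤ) : HH φ D i j →+ HH φ D i j :=
  AddMonoidHom.mk' (fun v => ⟨qpr φ hx i d v.1, qpr_mem φ hx i d j v.1 v.2⟩) (by
    intro v w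
    apply Subtype.ext
    exact map_add (qpr φ hx i d) v.1 w.1)

lemma isWt_X_C (k : Fin m) : IsWt (wx m n) 1 (C (X k) : PP K m n) :=
  isWt_C_homog (X k) 1 (isHomogeneous_X K k)

lemma inE_of_prE (w : Wt m n) {τ : Type} (a : τ → ℤ) (d : ℤ) (z : EE K m n τ)
    (h : prE w a d z = z) : InE w a d z := h ▸ inE_prE w a d z

lemma inE_smul_x {τ : Type} (a : τ → ℤ) (d δ : ℤ) (g : MvPolynomial (Fin m) K)
    (hg : IsWt (wx m n) δ (C g : PP K m n)) (z : EE K m n τ) (hz : InE (wx m n) a d z) :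
    InE (wx m n) a (d + δ) (g • z) := by
  apply inE_of_prE
  rw [prE_smul_x a _ δ g hg, add_sub_cancel_right, prE_of_inE _ _ _ _ hz]

lemma inE_smul_y {τ : Type} (a : τ → ℤ) (d : ℤ) (g : MvPolynomial (Fin m) K)
    (z : EE K m n τ) (hz : InE (-wy m n) a d z) :
    InE (-wy m n) a d (g • z) := by
  apply inE_of_prE
  rw [prE_smul_y, prE_of_inE _ _ _ _ hz]

lemma HyGr_X (i : ℕ) (j : ℤ) (k : Fin m) (e : ℤ) (v : HH φ D i j)
    (hv : v ∈ HyGr K m n σ φ D i j e) :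
    (X k : MvPolynomial (Fin m) K) • v ∈ HyGr K m n σ φ D i j (e + 1) := by
  rw [mem_HyGr] at hv ⊢
  obtain ⟨z, h1, h2, h3, h4⟩ := hv
  exact ⟨X k • z, Submodule.smul_mem _ _ h1, inE_smul_y _ _ _ _ h2,
    inE_smul_x _ _ _ _ (isWt_X_C k) _ h3, by rw [map_smul, h4]; rfl⟩

lemma HyGr_lower
    (hx : ∀ i, IsGr (wx m n) (fun s => (D (i + 1) s).1) (fun s => (D i s).1) (φ i))
    (i : ℕ) (j : ℤ) (e : ℤ) (h0 : HyGr K m n σ φ D i j (e - 1) = ⊥)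
    (h1 : HyGr K m n σ φ D i j e ≠ ⊥) :
    ∃ k : ℕ,
      Submodule.map ((LinearMap.range (kosD K m (HH φ D i j) k)).mkQ.restrictScalars K)
      (kosStrand K m (HH φ D i j) (HyGr K m n σ φ D i j) k (e + k) ⊓
        (kosKer K m (HH φ D i j) k).restrictScalars K) ≠ ⊥ := by
  refine kos_lower (HyGr K m n σ φ D i j) (hpr φ hx i j) ?_ ?_ ?_ e h0 h1
  · intro e v hv
    rw [mem_HyGr] at hv
    obtain ⟨z, h1, h2, h3, h4⟩ := hv
    apply Subtype.ext
    change qpr φ hx i e v.1 = v.1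
    rw [← h4, qpr_mk, prE_of_inE _ _ _ _ h3]
  · intro e v
    rw [mem_HyGr]
    obtain ⟨z, h1, h2, h4⟩ := (mem_HH φ D i j v.1).1 v.2
    refine ⟨_, hKer_prE_x φ hx i e z h1, inE_prE_of_inE _ _ _ _ _ _ _ h2, inE_prE _ _ _ _, ?_⟩
    change _ = qpr φ hx i e v.1
    rw [← h4, qpr_mk]
  · intro k e v
    obtain ⟨z, h1, h2, h4⟩ := (mem_HH φ D i j v.1).1 v.2
    apply Subtype.ext
    change qpr φ hx i e ((X k : MvPolynomial (Fin m) K) • v.1) =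
      (X k : MvPolynomial (Fin m) K) • qpr φ hx i (e - 1) v.1
    rw [← h4, ← map_smul, qpr_mk, qpr_mk, ← map_smul, prE_smul_x _ _ 1 _ (isWt_X_C k)]

lemma HyGr_eq_bot (i : ℕ) (j e : ℤ) (he : ∀ s : σ i, e < (D i s).1) :
    HyGr K m n σ φ D i j e = ⊥ := by
  rw [eq_bot_iff]
  intro v hv
  rw [mem_HyGr] at hv
  obtain ⟨z, -, -, h3, h4⟩ := hv
  have : z = 0 := by
    ext ⟨s, c⟩ ν
    by_contra h
    have h5 := h3 s c ν h
    rw [wx_apply] at h5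
    dsimp only at h5
    have := he s
    omega
  rw [this, map_zero] at h4
  exact Subtype.ext h4.symm

lemma exists_HyGr_ne_bot [∀ i, Finite (σ i)]
    (hx : ∀ i, IsGr (wx m n) (fun s => (D (i + 1) s).1) (fun s => (D i s).1) (φ i))
    (i : ℕ) (j : ℤ) (h : HH φ D i j ≠ ⊥) : ∃ e, HyGr K m n σ φ D i j e ≠ ⊥ := by
  by_contra hcon
  push Not at hcon
  apply h
  rw [eq_bot_iff]
  intro v hv
  obtain ⟨z, h1, h2, h4⟩ := (mem_HH φ D i j v).1 hv
  obtain ⟨t, ht⟩ := exists_lift z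
  obtain ⟨f, hf⟩ := ht t le_rfl
  obtain ⟨T, hT⟩ := exists_pr_sum (wx m n) (fun s => (D i s).1) f
  have hz : z = ∑ d ∈ T, prE (wx m n) (fun s => (D i s).1) d z := by
    conv_lhs => rw [← hf, ← hT, map_sum]
    refine Finset.sum_congr rfl fun d _ => ?_
    rw [← rho_prE_x, hf]
  rw [Submodule.mem_bot, ← h4, hz, map_sum]
  refine Finset.sum_eq_zero fun d _ => ?_
  have hm : (Bd φ i).mkQ (prE (wx m n) (fun s => (D i s).1) d z) ∈ HH φ D i j := by
    rw [mem_HH]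
    exact ⟨_, hKer_prE_x φ hx i d z h1, inE_prE_of_inE _ _ _ _ _ _ _ h2, rfl⟩
  have hm2 : (⟨_, hm⟩ : HH φ D i j) ∈ HyGr K m n σ φ D i j d := by
    rw [mem_HyGr]
    exact ⟨_, hKer_prE_x φ hx i d z h1, inE_prE_of_inE _ _ _ _ _ _ _ h2, inE_prE _ _ _ _, rfl⟩
  rw [hcon d, Submodule.mem_bot] at hm2
  exact congrArg Subtype.val hm2

lemma HyGr_upper
    (hx : ∀ i, IsGr (wx m n) (fun s => (D (i + 1) s).1) (fun s => (D i s).1) (φ i))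
    (hy : ∀ i, IsGr (wy m n) (fun s => (D (i + 1) s).2) (fun s => (D i s).2) (φ i))
    (hexact : ∀ i, Function.Exact (φ (i + 1)) (φ i))
    (g : MvPolynomial (Fin m) K) (δ : ℕ) (hδ : 1 ≤ δ) (hg : g.IsHomogeneous δ) (B : ℤ)
    (hB : ∀ d, B ≤ d → 
      (∀ y, pr (wx m n) (fun s => (D 0 s).1) d y = y →
        ∃ u, ∃ v ∈ LinearMap.range (φ 0), (C g : PP K m n) • u + v = y) ∧
      (∀ y, pr (wx m n) (fun s => (D 0 s).1) d y = y → (C g : PP K m n) • y ∈ LinearMap.range (φ 0) →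
        y ∈ LinearMap.range (φ 0)))
    (i : ℕ) (j e : ℤ) (he : ∃ k : ℕ,
      Submodule.map ((LinearMap.range (kosD K m (HH φ D i j) k)).mkQ.restrictScalars K)
      (kosStrand K m (HH φ D i j) (HyGr K m n σ φ D i j) k (e + k) ⊓
        (kosKer K m (HH φ D i j) k).restrictScalars K) ≠ ⊥) : e ≤ B + δ + δ := by
  have hgw : IsWt (wx m n) δ (C g : PP K m n) := isWt_C_homog g δ hg
  have hcone : ∀ d, B + δ ≤ d → _ := fun d hd =>
    cone_homotopy φ (fun i s => (D i s).1) hx hexact g δ hgw d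
      (by
        intro y hy
        obtain ⟨u, _, ⟨v, rfl⟩, h⟩ := (hB d (by omega)).1 y hy
        exact ⟨u, v, h⟩)
      (fun y hy => (hB (d - δ) (by omega)).2 y hy)
  refine kos_upper (HyGr K m n σ φ D i j) δ g (homog_mem_vars g δ hδ hg) (B + δ)
    (fun k e v hv => HyGr_X φ i j k e v hv) ?_ ?_ e he
  · intro e he v hv
    rw [mem_HyGr] at hv
    obtain ⟨z, h1, h2, h3, h4⟩ := hv
    obtain ⟨s, hs⟩ := hcone e he
    obtain ⟨w, hw, u, hu⟩ := surj_of_homotopy φ (fun i s => (D i s).1) g δ e s hs i z h1 h3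
    set w1 := prE (wx m n) (fun s => (D i s).1) (e - δ) w with hw1
    set w2 := prE (-wy m n) (fun s => (D i s).2) (j + n) w1 with hw2
    have k1 : w2 ∈ hKer (MvPolynomial (Fin m) K) n σ φ i :=
      hKer_prE_y φ hy i _ _ (hKer_prE_x φ hx i _ _ hw)
    have k2 : InE (-wy m n) (fun s => (D i s).2) (j + n) w2 := inE_prE _ _ _ _
    have k3 : InE (wx m n) (fun s => (D i s).1) (e - δ) w2 :=
      inE_prE_of_inE _ _ _ _ _ _ _ (inE_prE _ _ _ _)
    have hm : (Bd φ i).mkQ w2 ∈ HH φ D i j := (mem_HH _ _ _ _ _).2 ⟨w2, k1, k2, rfl⟩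
    refine ⟨⟨_, hm⟩, (mem_HyGr _ _ _ _ _ _).2 ⟨w2, k1, k2, k3, rfl⟩, ?_⟩
    apply Subtype.ext
    change g • (Bd φ i).mkQ w2 = v.1
    rw [← h4, ← map_smul]
    have hz : g • w2 + emap (MvPolynomial (Fin m) K) n (φ i)
        (prE (-wy m n) (fun s => (D (i + 1) s).2) (j + n)
          (prE (wx m n) (fun s => (D (i + 1) s).1) e u)) = z := by
      rw [← emap_prE_y _ _ _ (hy i), ← emap_prE_x _ _ _ (hx i), hw2, ← prE_smul_y, hw1,
        ← prE_smul_x _ _ _ _ hgw, ← map_add, ← map_add, hu, prE_of_inE _ _ _ _ h3,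
        prE_of_inE _ _ _ _ h2]
    rw [← hz, map_add]
    refine (add_eq_left.2 ?_).symm
    rw [Submodule.mkQ_apply, Submodule.Quotient.mk_eq_zero]
    exact ⟨_, rfl⟩
  · intro e he v hv hgv
    rw [mem_HyGr] at hv
    obtain ⟨z, h1, h2, h3, h4⟩ := hv
    obtain ⟨s, hs⟩ := hcone (e + δ) (by omega)
    have hgv' : g • v.1 = 0 := congrArg Subtype.val hgv
    rw [← h4, ← map_smul, Submodule.mkQ_apply, Submodule.Quotient.mk_eq_zero] at hgv'
    have := inj_of_homotopy φ (fun i s => (D i s).1) g δ (e + δ) s hs i z h1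
      (by rw [add_sub_cancel_right]; exact h3) hgv'
    apply Subtype.ext
    rw [← h4]
    exact (Submodule.Quotient.mk_eq_zero _).2 this

end CohSide
end PaperAux

open MvPolynomial

namespace PaperAux
open Paper

section Final
set_option maxSynthPendingDepth 10

lemma final_bound
    (K : Type) [Field K] (m n : ℕ)
    (M : Type) [AddCommGroup M] [Module (MvPolynomial (Fin m) K) M]
    [Module (PP K m n) M]
    [IsScalarTower (MvPolynomial (Fin m) K) (PP K m n) M]
    (σ : ℕ → Type) [∀ i, Fintype (σ i)]
    (D : ∀ i, σ i → ℤ × ℤ)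
    (φ : ∀ i, ((σ (i + 1)) →₀ PP K m n) →ₗ[PP K m n] ((σ i) →₀ PP K m n))
    (ε : ((σ 0) →₀ PP K m n) →ₗ[PP K m n] M)
    (hsurj : Function.Surjective ε)
    (hexact₀ : Function.Exact (φ 0) ε)
    (hexact : ∀ i, Function.Exact (φ (i + 1)) (φ i))
    (hφgr : ∀ i s' s β ν,
      MvPolynomial.coeff ν (MvPolynomial.coeff β ((φ i (Finsupp.single s' 1)) s)) ≠ 0 →
      (tdeg ν : ℤ) = (D (i + 1) s').1 - (D i s).1 ∧
        (tdeg β : ℤ) = (D (i + 1) s').2 - (D i s).2)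
    (hdim : ringKrullDim ((MvPolynomial (Fin m) K) ⧸
        Module.annihilator (MvPolynomial (Fin m) K)
          (M ⧸ Submodule.restrictScalars (MvPolynomial (Fin m) K)
            ((Ideal.span (Set.range (MvPolynomial.X : Fin n → PP K m n))) •
              (⊤ : Submodule (PP K m n) M)))) ≤ 1) (i : ℕ) :
    ∃ C : ℤ, ∀ j : ℤ,
      Hy (MvPolynomial (Fin m) K) n σ φ (fun i s => (D i s).2) i j ≠ ⊥ →
      |CMreg K m ↥(Hy (MvPolynomial (Fin m) K) n σ φ (fun i s => (D i s).2) i j)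
          (HyGr K m n σ φ D i j)| ≤ C := by
  have hx : ∀ i, IsGr (wx m n) (fun s => (D (i + 1) s).1) (fun s => (D i s).1) (φ i) :=
    fun i t s β ν h => (hφgr i t s β ν h).1
  have hy : ∀ i, IsGr (wy m n) (fun s => (D (i + 1) s).2) (fun s => (D i s).2) (φ i) :=
    fun i t s β ν h => (hφgr i t s β ν h).2
  have hker : LinearMap.ker ε = LinearMap.range (φ 0) := LinearMap.exact_iff.1 hexact₀
  have hQx : ∀ d, ∀ q ∈ LinearMap.range (φ 0),
      pr (wx m n) (fun s => (D 0 s).1) d q ∈ LinearMap.range (φ 0) := by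
    rintro d _ ⟨v, rfl⟩
    rw [pr_comm _ _ _ _ (hx 0)]
    exact ⟨_, rfl⟩
  have hQy : ∀ d, ∀ q ∈ LinearMap.range (φ 0),
      pr (wy m n) (fun s => (D 0 s).2) d q ∈ LinearMap.range (φ 0) := by
    rintro d _ ⟨v, rfl⟩
    rw [pr_comm _ _ _ _ (hy 0)]
    exact ⟨_, rfl⟩
  obtain ⟨δ, hδ, g, hg, N, hN⟩ := exists_param _
    (fun u hu e => ann_homog ε hsurj (fun s => (D 0 s).1) (by rw [hker]; exact hQx) u hu e) hdim
  obtain ⟨B, hB⟩ := M_facts (fun s => (D 0 s).1) (fun s => (D 0 s).2) (LinearMap.range (φ 0))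
    hQx hQy _ (fun u hu f => by
      have := (mem_ann_iff ε hsurj u).1 hu f
      rw [hker] at this
      exact this) g N hN
  obtain ⟨L, hL⟩ : ∃ L : ℤ, ∀ s : σ i, L ≤ (D i s).1 := by
    obtain ⟨L, hL⟩ := (Set.finite_range (fun s : σ i => (D i s).1)).bddBelow
    exact ⟨L, fun s => hL ⟨s, rfl⟩⟩
  refine ⟨max |L| |B + δ + δ|, fun j hj => ?_⟩
  have hup := HyGr_upper φ hx hy hexact g δ hδ hg B hB i j
  obtain ⟨e, he, hmin⟩ := Int.exists_least_of_bdd (P := fun e => HyGr K m n σ φ D i j e ≠ ⊥)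
    ⟨L, fun e he => by
      by_contra hlt
      push Not at hlt
      exact he (HyGr_eq_bot φ i j e fun s => hlt.trans_le (hL s))⟩
    (exists_HyGr_ne_bot φ hx i j hj)
  have h0 : HyGr K m n σ φ D i j (e - 1) = ⊥ := by
    by_contra h
    have := hmin _ h
    omega
  have hLe : L ≤ e := by
    by_contra hlt
    push Not at hlt
    exact he (HyGr_eq_bot φ i j e fun s => hlt.trans_le (hL s))
  have hlow := HyGr_lower φ hx i j e h0 he
  have h1 : CMreg K m ↥(HH φ D i j) (HyGr K m n σ φ D i j) ≤ B + δ + δ :=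
    csSup_le ⟨e, hlow⟩ hup
  have h2 : e ≤ CMreg K m ↥(HH φ D i j) (HyGr K m n σ φ D i j) :=
    le_csSup ⟨B + δ + δ, hup⟩ hlow
  exact abs_le_max_abs_abs (hLe.trans h2) h1

end Final
end PaperAux

namespace Paper


/-- **Theorem (paper, Theorem 2.5).** Let `M` be a finitely generated bigraded `P`-module
with `dim_{P₀} M/P₊M ≤ 1`.  Then for every `i` the function
`f_{i,M}(j) = reg H^i_{P₊}(M)_j` is bounded: there is a constant `C` with
`|reg H^i_{P₊}(M)_j| ≤ C` whenever `H^i_{P₊}(M)_j ≠ 0`.  Here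
`H^{n-i}_{P₊}(M)_j = H_i(H^n_{P₊}(F))_j` is computed from a bigraded free resolution `F` of
`M` (Theorem 1.1 of the paper) and `reg` is Castelnuovo–Mumford regularity over `P₀`. -/
theorem regularity_of_local_cohomology_bounded
    (K : Type) [Field K] (m n : ℕ)
    (M : Type) [AddCommGroup M]
    [Module K M] [Module (MvPolynomial (Fin m) K) M]
    [Module (MvPolynomial (Fin n) (MvPolynomial (Fin m) K)) M]
    [IsScalarTower K (MvPolynomial (Fin m) K) M]
    [IsScalarTower (MvPolynomial (Fin m) K)
      (MvPolynomial (Fin n) (MvPolynomial (Fin m) K)) M]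
    [Module.Finite (MvPolynomial (Fin n) (MvPolynomial (Fin m) K)) M]
    -- a bigrading of `M`, compatible with the bigrading of `P`:
    (ℳ : ℤ × ℤ → Submodule K M)
    (hdecomp : DirectSum.IsInternal ℳ)
    (hsmul : ∀ (a b : ℕ) (p : MvPolynomial (Fin n) (MvPolynomial (Fin m) K)),
      IsBihom K m n p a b →
      ∀ (v : ℤ × ℤ) (x : M), x ∈ ℳ v → p • x ∈ ℳ (v.1 + a, v.2 + b))
    -- a bigraded free resolution `⋯ → F₁ → F₀ → M → 0` of `M`,
    -- with `Fᵢ = ⊕_{s : σ i} P(-(D i s).1, -(D i s).2)`: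
    (σ : ℕ → Type) [∀ i, Fintype (σ i)]
    (D : ∀ i, σ i → ℤ × ℤ)
    (φ : ∀ i, ((σ (i + 1)) →₀ MvPolynomial (Fin n) (MvPolynomial (Fin m) K))
      →ₗ[MvPolynomial (Fin n) (MvPolynomial (Fin m) K)]
      ((σ i) →₀ MvPolynomial (Fin n) (MvPolynomial (Fin m) K)))
    (ε : ((σ 0) →₀ MvPolynomial (Fin n) (MvPolynomial (Fin m) K))
      →ₗ[MvPolynomial (Fin n) (MvPolynomial (Fin m) K)] M)
    (hsurj : Function.Surjective ε)
    (hexact₀ : Function.Exact (φ 0) ε)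
    (hexact : ∀ i, Function.Exact (φ (i + 1)) (φ i))
    (hφgr : ∀ i s' s β ν,
      MvPolynomial.coeff ν (MvPolynomial.coeff β ((φ i (Finsupp.single s' 1)) s)) ≠ 0 →
      (tdeg ν : ℤ) = (D (i + 1) s').1 - (D i s).1 ∧
        (tdeg β : ℤ) = (D (i + 1) s').2 - (D i s).2)
    (hεgr : ∀ s, ε (Finsupp.single s 1) ∈ ℳ (D 0 s))
    (hdim : ringKrullDim ((MvPolynomial (Fin m) K) ⧸
        Module.annihilator (MvPolynomial (Fin m) K)
          (M ⧸ Submodule.restrictScalars (MvPolynomial (Fin m) K)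
            ((Ideal.span (Set.range (MvPolynomial.X :
                Fin n → MvPolynomial (Fin n) (MvPolynomial (Fin m) K)))) •
              (⊤ : Submodule (MvPolynomial (Fin n) (MvPolynomial (Fin m) K)) M)))) ≤ 1) :
    ∀ i : ℕ, ∃ C : ℤ, ∀ j : ℤ,
      Hy (MvPolynomial (Fin m) K) n σ φ (fun i s => (D i s).2) i j ≠ ⊥ →
      |CMreg K m ↥(Hy (MvPolynomial (Fin m) K) n σ φ (fun i s => (D i s).2) i j)
          (HyGr K m n σ φ D i j)| ≤ C := by
  exact PaperAux.final_bound K m n M σ D φ ε hsurj hexact₀ hexact hφgr hdim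

end Paper
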